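/- arXiv:1106.6316 — 2 statements merged into one kernel-verified Lean document; each statement's English description precedes it below -/
import Mathlib

section
/- Let Ω be second countable, T a positive strong Feller operator on B_b(Ω), and μ ≠ 0 a positive finite T-invariant Borel measure such that for every x ∈ Ω there exists k_x ∈ L¹(Ω,μ) with (Tf)(x) = ∫ k_x f dμ for all f ∈ B_b(Ω). Then for each c ≥ 0 the family { T²f : f ∈ B_b(Ω), |f| ≤ c } is equicontinuous on Ω. -/
open MeasureTheory Filter Topology Set

/-- `Bb f`: `f` is a bounded Borel measurable real-valued function. -/
def Bb {Ω : Type*} [MeasurableSpace Ω] (f : Ω → ℝ) : Prop :=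
  Measurable f ∧ ∃ C : ℝ, ∀ x, |f x| ≤ C

/-- The functional `k ↦ ∫ k f` on `L¹`. -/
theorem aux_functional {Ω : Type*} [MeasurableSpace Ω] (μ : Measure Ω) (f : Ω → ℝ)
    (hf : Measurable f) (c : ℝ) (hc : ∀ z, |f z| ≤ c) :
    ∃ φ : (Lp ℝ 1 μ) →L[ℝ] ℝ, ‖φ‖ ≤ max c 0 ∧ ∀ k, φ k = ∫ y, k y * f y ∂μ := by
  have hint : ∀ k : Lp ℝ 1 μ, Integrable (fun y => k y * f y) μ := fun k =>
    (L1.integrable_coeFn k).mul_bdd (c := c) hf.aestronglyMeasurable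
      (Eventually.of_forall fun z => by simpa using hc z)
  let L : (Lp ℝ 1 μ) →ₗ[ℝ] ℝ :=
    { toFun := fun k => ∫ y, k y * f y ∂μ
      map_add' := by
        intro a b
        rw [← integral_add (hint a) (hint b)]
        apply integral_congr_ae
        filter_upwards [Lp.coeFn_add a b] with y hy
        rw [hy, Pi.add_apply]; ring
      map_smul' := by
        intro r a
        rw [RingHom.id_apply, smul_eq_mul, ← integral_const_mul]
        apply integral_congr_ae
        filter_upwards [Lp.coeFn_smul r a] with y hy
        rw [hy, Pi.smul_apply, smul_eq_mul]; ring }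
  have hb : ∀ k, ‖L k‖ ≤ max c 0 * ‖k‖ := by
    intro k
    calc ‖L k‖ ≤ ∫ y, ‖k y * f y‖ ∂μ := norm_integral_le_integral_norm _
      _ ≤ ∫ y, max c 0 * ‖k y‖ ∂μ := by
          apply integral_mono (hint k).norm ((L1.integrable_coeFn k).norm.const_mul _)
          intro y
          simp only [norm_mul]
          rw [mul_comm]
          exact mul_le_mul_of_nonneg_right ((hc y).trans (le_max_left _ _)) (norm_nonneg _)
      _ = max c 0 * ‖k‖ := by rw [integral_const_mul, L1.norm_eq_integral_norm]
  exact ⟨L.mkContinuous _ hb, L.mkContinuous_norm_le (le_max_right _ _) hb, fun k => rfl⟩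

theorem aux_subseq {Ω : Type*} [MeasurableSpace Ω] (μ : Measure Ω) [IsFiniteMeasure μ]
    [MeasurableSpace.CountablyGenerated Ω] (f : ℕ → Ω → ℝ)
    (hf : ∀ n, Measurable (f n)) (c : ℝ) (hc : ∀ n z, |f n z| ≤ c) :
    ∃ s : ℕ → ℕ, StrictMono s ∧ ∀ k : Ω → ℝ, Integrable k μ →
      ∃ l : ℝ, Tendsto (fun n => ∫ y, k y * f (s n) y ∂μ) atTop (𝓝 l) := by
  choose φ hφ hφk using fun n => aux_functional μ (f n) (hf n) c (hc n)
  have : Fact ((1 : ENNReal) ≠ ⊤) := ⟨ENNReal.one_ne_top⟩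
  have hsc := WeakDual.isSeqCompact_closedBall ℝ (Lp ℝ 1 μ) 0 (max c 0)
  obtain ⟨ψ, -, s, hs, hlim⟩ := hsc (x := fun n => StrongDual.toWeakDual (φ n)) (by
    intro n
    simpa using hφ n)
  refine ⟨s, hs, fun k hk => ?_⟩
  have h1 := ((WeakDual.eval_continuous (hk.toL1 k)).tendsto ψ).comp hlim
  refine ⟨ψ (hk.toL1 k), h1.congr fun n => ?_⟩
  change φ (s n) (hk.toL1 k) = _
  rw [hφk]
  apply integral_congr_ae
  filter_upwards [hk.coeFn_toL1] with y hy
  rw [hy]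

theorem stmt_6 {Ω : Type*} [TopologicalSpace Ω] [T2Space Ω] [SecondCountableTopology Ω]
    [MeasurableSpace Ω] [BorelSpace Ω]
    (μ : Measure Ω) [IsFiniteMeasure μ] (hμ : μ ≠ 0)
    (T : (Ω → ℝ) → (Ω → ℝ))
    (hTBb : ∀ f, Bb f → Bb (T f))
    (hadd : ∀ f g, Bb f → Bb g → T (f + g) = T f + T g)
    (hsmul : ∀ (c : ℝ) (f), Bb f → T (c • f) = c • T f)
    (hpos : ∀ f, Bb f → (∀ x, 0 ≤ f x) → ∀ x, 0 ≤ T f x)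
    (hSF : ∀ f, Bb f → Continuous (T f))
    (hdens : ∀ x : Ω, ∃ kx : Ω → ℝ, Integrable kx μ ∧
      ∀ f, Bb f → T f x = ∫ y, kx y * f y ∂μ)
    (hinv : ∀ f, Bb f → ∫ x, T f x ∂μ = ∫ x, f x ∂μ) :
    ∀ c : ℝ, 0 ≤ c → ∀ x : Ω, ∀ ε > (0 : ℝ), ∃ U : Set Ω, IsOpen U ∧ x ∈ U ∧
      ∀ y ∈ U, ∀ f, Bb f → (∀ z, |f z| ≤ c) → |T (T f) y - T (T f) x| < ε := by
  intro c hc0 x ε hε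
  by_contra hcon
  push Not at hcon
  obtain ⟨V, hVo, hV⟩ := (nhds_basis_opens x).exists_antitone_subbasis
  choose y hyV f hfB hfc hfε using fun n => hcon (V n) (hVo n).2 (hVo n).1
  have hy : Tendsto y atTop (𝓝 x) := hV.tendsto hyV
  -- basic facts on `T`
  have hsmulB : ∀ (r : ℝ) (g : Ω → ℝ), Bb g → Bb (r • g) := by
    rintro r g ⟨hg, C, hC⟩
    refine ⟨hg.const_smul r, |r| * C, fun z => ?_⟩
    rw [Pi.smul_apply, smul_eq_mul, abs_mul]
    exact mul_le_mul_of_nonneg_left (hC z) (abs_nonneg _)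
  have hsubB : ∀ g h : Ω → ℝ, Bb g → Bb h → Bb (g - h) := by
    rintro g h ⟨hg, C, hC⟩ ⟨hh, D, hD⟩
    exact ⟨hg.sub hh, C + D, fun z => (abs_sub _ _).trans (add_le_add (hC z) (hD z))⟩
  have hsub : ∀ g h : Ω → ℝ, Bb g → Bb h → ∀ z, T (g - h) z = T g z - T h z := by
    intro g h hg hh z
    have h1 := hadd (g - h) h (hsubB g h hg hh) hh
    rw [sub_add_cancel] at h1
    rw [h1, Pi.add_apply]; ring
  have hmono : ∀ g h : Ω → ℝ, Bb g → Bb h → (∀ z, g z ≤ h z) → ∀ z, T g z ≤ T h z := by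
    intro g h hg hh hle z
    have := hpos (h - g) (hsubB h g hh hg) (fun w => sub_nonneg.2 (hle w)) z
    rw [hsub h g hh hg] at this
    linarith
  have habs : ∀ g h : Ω → ℝ, Bb g → Bb h → (∀ z, |g z| ≤ h z) → ∀ z, |T g z| ≤ T h z := by
    intro g h hg hh hle z
    have h1 := hmono g h hg hh (fun w => (le_abs_self _).trans (hle w)) z
    have h2 := hmono ((-1 : ℝ) • g) h (hsmulB _ g hg) hh (fun w => by
      simpa using (neg_le_abs (g w)).trans (hle w)) z
    rw [hsmul _ g hg] at h2
    simp at h2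
    exact abs_le.2 ⟨by linarith, h1⟩
  have hconstB : Bb (fun _ : Ω => c) := ⟨measurable_const, |c|, fun _ => le_rfl⟩
  obtain ⟨-, M, hM⟩ := hTBb _ hconstB
  have hgM0 : ∀ n z, |T (f n) z| ≤ M := fun n z =>
    (habs _ _ (hfB n) hconstB (hfc n) z).trans ((le_abs_self _).trans (hM z))
  -- a subsequence along which `T f` converges pointwise
  obtain ⟨s, hs, hconv⟩ := aux_subseq μ f (fun n => (hfB n).1) c hfc
  have hconv2 : ∀ z, ∃ l, Tendsto (fun n => T (f (s n)) z) atTop (𝓝 l) := by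
    intro z
    obtain ⟨k, hk, hkT⟩ := hdens z
    obtain ⟨l, hl⟩ := hconv k hk
    exact ⟨l, hl.congr fun n => (hkT _ (hfB _)).symm⟩
  choose g hg using hconv2
  have hGB : ∀ n, Bb (T (f (s n))) := fun n => hTBb _ (hfB _)
  have hgB : Bb g := by
    refine ⟨measurable_of_tendsto_metrizable (fun n => (hGB n).1) (tendsto_pi_nhds.2 hg), M, ?_⟩
    intro z
    exact le_of_tendsto (hg z).abs (Eventually.of_forall fun n => hgM0 _ z)
  obtain ⟨hgm, M', hgM⟩ := id hgB
  have hdB : ∀ n, Bb (T (f (s n)) - g) := fun n => hsubB _ _ (hGB n) hgB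
  have hdM : ∀ n z, |(T (f (s n)) - g) z| ≤ M + M' := fun n z =>
    (abs_sub _ _).trans (add_le_add (hgM0 _ z) (hgM z))
  let h : ℕ → Ω → ℝ := fun k z => ⨆ j, |(T (f (s (j + k))) - g) z|
  have hbdd : ∀ k z, BddAbove (range fun j => |(T (f (s (j + k))) - g) z|) := fun k z =>
    ⟨M + M', by rintro _ ⟨j, rfl⟩; exact hdM _ z⟩
  have hle : ∀ k j, k ≤ j → ∀ z, |(T (f (s j)) - g) z| ≤ h k z := by
    intro k j hkj z
    have := le_ciSup (hbdd k z) (j - k)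
    simpa only [Nat.sub_add_cancel hkj] using this
  have hh0 : ∀ k z, 0 ≤ h k z := fun k z => (abs_nonneg _).trans (hle k k le_rfl z)
  have hhM : ∀ k z, |h k z| ≤ M + M' := fun k z => by
    rw [abs_of_nonneg (hh0 k z)]
    exact ciSup_le fun j => hdM _ z
  have hhB : ∀ k, Bb (h k) := fun k =>
    ⟨Measurable.iSup fun j => (hdB (j + k)).1.abs, M + M', hhM k⟩
  have hhlim : ∀ z, Tendsto (fun k => h k z) atTop (𝓝 0) := by
    intro z
    rw [Metric.tendsto_atTop]
    intro δ hδ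
    obtain ⟨N, hN⟩ := Metric.tendsto_atTop.1 (hg z) (δ / 2) (half_pos hδ)
    refine ⟨N, fun n hn => ?_⟩
    rw [Real.dist_eq, sub_zero, abs_of_nonneg (hh0 n z)]
    refine lt_of_le_of_lt (ciSup_le fun j => ?_) (half_lt_self hδ)
    have := hN (j + n) (by omega)
    rw [Real.dist_eq] at this
    exact this.le
  have hThlim : Tendsto (fun k => T (h k) x) atTop (𝓝 0) := by
    obtain ⟨k, hk, hkT⟩ := hdens x
    have : Tendsto (fun n => ∫ z, k z * h n z ∂μ) atTop (𝓝 (∫ z, (0 : ℝ) ∂μ)) := by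
      apply tendsto_integral_of_dominated_convergence (fun z => ‖k z‖ * (M + M'))
      · intro n
        exact hk.aestronglyMeasurable.mul (hhB n).1.aestronglyMeasurable
      · exact hk.norm.mul_const _
      · intro n
        refine Eventually.of_forall fun z => ?_
        rw [norm_mul]
        exact mul_le_mul_of_nonneg_left (hhM n z) (norm_nonneg _)
      · refine Eventually.of_forall fun z => ?_
        simpa using (hhlim z).const_mul (k z)
    rw [integral_zero] at this
    exact this.congr fun n => (hkT _ (hhB n)).symm
  obtain ⟨k, hk⟩ := (hThlim.eventually (gt_mem_nhds (show 0 < ε / 4 by linarith))).exists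
  have hys : Tendsto (fun n => y (s n)) atTop (𝓝 x) := hy.comp hs.tendsto_atTop
  have e1 := (((hSF _ (hhB k)).tendsto x).comp hys).eventually (gt_mem_nhds hk)
  have e2 := Metric.tendsto_nhds.1 (((hSF _ hgB).tendsto x).comp hys) (ε / 4) (by linarith)
  obtain ⟨j, ⟨hj1, hj2⟩, hj3⟩ := ((e1.and e2).and (eventually_ge_atTop k)).exists
  simp only [Function.comp_apply, Real.dist_eq] at hj1 hj2
  have a1 := habs _ _ (hdB j) (hhB k) (hle k j hj3) (y (s j))
  have a2 := habs _ _ (hdB j) (hhB k) (hle k j hj3) x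
  rw [hsub _ _ (hGB j) hgB] at a1 a2
  have a3 := hfε (s j)
  have b1 := abs_le.1 a1
  have b2 := abs_le.1 a2
  have b3 := abs_lt.1 hj2
  have : |T (T (f (s j))) (y (s j)) - T (T (f (s j))) x| < ε := by
    rw [abs_lt]
    constructor <;> linarith [b1.1, b1.2, b2.1, b2.2, b3.1, b3.2]
  linarith
end

section
/- Let Ω be second countable, (T(t))_{t≥0} a positive, bounded strong Feller semigroup on B_b(Ω) such that T(t)'δ_x is a Borel measure for all x ∈ Ω and t > 0, and μ a positive, finite, strictly positive invariant Borel measure whose induced semigroup on L¹(Ω,μ) is irreducible and strongly continuous at 0 (∫ |T(t)f − f| dμ → 0 as t → 0 for all f ∈ B_b(Ω)). Then there exists e ∈ fix(T) with e > 0 μ-a.e., fix(T) = span{e}, and for every f ∈ B_b(Ω), T(t)f → (∫ f dμ) e as t → ∞, uniformly on compact subsets of Ω. -/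
open MeasureTheory Filter Topology Set

namespace DoobAux

set_option linter.unusedSectionVars false

section basics

variable {Ω : Type*} [MeasurableSpace Ω] {f g : Ω → ℝ}

theorem bb_const (c : ℝ) : Bb (fun _ : Ω => c) := ⟨measurable_const, |c|, fun _ => le_rfl⟩

theorem bb_add (hf : Bb f) (hg : Bb g) : Bb (f + g) := by
  obtain ⟨hf, C, hC⟩ := hf
  obtain ⟨hg, D, hD⟩ := hg
  exact ⟨hf.add hg, C + D, fun x => (abs_add_le _ _).trans (add_le_add (hC x) (hD x))⟩

theorem bb_smul (c : ℝ) (hf : Bb f) : Bb (c • f) := by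
  obtain ⟨hf, C, hC⟩ := hf
  refine ⟨hf.const_smul c, |c| * C, fun x => ?_⟩
  simp only [Pi.smul_apply, smul_eq_mul, abs_mul]
  exact mul_le_mul_of_nonneg_left (hC x) (abs_nonneg _)

theorem bb_sub (hf : Bb f) (hg : Bb g) : Bb (f - g) := by
  obtain ⟨hf, C, hC⟩ := hf
  obtain ⟨hg, D, hD⟩ := hg
  exact ⟨hf.sub hg, C + D, fun x => (abs_sub _ _).trans (add_le_add (hC x) (hD x))⟩

theorem bb_abs (hf : Bb f) : Bb (fun x => |f x|) := by
  obtain ⟨hf, C, hC⟩ := hf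
  exact ⟨hf.abs, C, fun x => by simpa using hC x⟩

theorem bb_min (hf : Bb f) (hg : Bb g) : Bb (fun x => min (f x) (g x)) := by
  obtain ⟨hf, C, hC⟩ := hf
  obtain ⟨hg, D, hD⟩ := hg
  refine ⟨hf.min hg, C + D, fun x => ?_⟩
  have h1 := abs_le.1 (hC x)
  have h2 := abs_le.1 (hD x)
  show |min (f x) (g x)| ≤ C + D
  rcases min_choice (f x) (g x) with h | h <;> rw [h, abs_le] <;> constructor <;> linarith

theorem bb_sum {ι : Type*} (s : Finset ι) {F : ι → Ω → ℝ} (hF : ∀ i, Bb (F i)) :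
    Bb (∑ i ∈ s, F i) := by
  classical
  induction s using Finset.induction_on with
  | empty => exact bb_const 0
  | insert a s ha ih => rw [Finset.sum_insert ha]; exact bb_add (hF a) ih

theorem bb_int (μ : Measure Ω) [IsFiniteMeasure μ] (hf : Bb f) : Integrable f μ := by
  obtain ⟨hf, C, hC⟩ := hf
  exact Integrable.of_bound hf.aestronglyMeasurable C (Eventually.of_forall hC)

/-- the `L¹`-seminorm -/
noncomputable def N (μ : Measure Ω) (f : Ω → ℝ) : ℝ := ∫ x, |f x| ∂μ

variable (μ : Measure Ω) [IsFiniteMeasure μ]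

theorem N_nonneg (f : Ω → ℝ) : 0 ≤ N μ f := integral_nonneg fun _ => abs_nonneg _

theorem N_add (hf : Bb f) (hg : Bb g) : N μ (f + g) ≤ N μ f + N μ g := by
  unfold N
  rw [← integral_add (bb_int μ (bb_abs hf)) (bb_int μ (bb_abs hg))]
  exact integral_mono (bb_int μ (bb_abs (bb_add hf hg)))
    ((bb_int μ (bb_abs hf)).add (bb_int μ (bb_abs hg))) fun x => abs_add_le _ _

theorem N_tri {h : Ω → ℝ} (hf : Bb f) (hg : Bb g) (hh : Bb h) :
    N μ (f - h) ≤ N μ (f - g) + N μ (g - h) := by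
  have := N_add μ (bb_sub hf hg) (bb_sub hg hh)
  rwa [sub_add_sub_cancel] at this

theorem N_comm : N μ (f - g) = N μ (g - f) := by
  unfold N
  congr 1; ext x; exact abs_sub_comm _ _

theorem N_smul (c : ℝ) : N μ (c • f) = |c| * N μ f := by
  unfold N
  simp only [Pi.smul_apply, smul_eq_mul, abs_mul]
  rw [integral_const_mul]

theorem N_mono (hf : Bb f) (hg : Bb g) (h : ∀ x, |f x| ≤ |g x|) : N μ f ≤ N μ g :=
  integral_mono (bb_int μ (bb_abs hf)) (bb_int μ (bb_abs hg)) h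

theorem N_eq_zero (hf : Bb f) : N μ f = 0 ↔ f =ᵐ[μ] 0 := by
  unfold N
  rw [integral_eq_zero_iff_of_nonneg (fun _ => abs_nonneg _) (bb_int μ (bb_abs hf))]
  constructor <;> intro h <;> filter_upwards [h] with x hx <;> simpa using hx

theorem ae_eq_of_N (hf : Bb f) (hg : Bb g) (h : N μ (f - g) = 0) : f =ᵐ[μ] g := by
  have := (N_eq_zero μ (bb_sub hf hg)).1 h
  filter_upwards [this] with x hx
  simpa [sub_eq_zero] using hx

theorem N_congr (h : f =ᵐ[μ] g) : N μ f = N μ g := by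
  unfold N
  refine integral_congr_ae ?_
  filter_upwards [h] with x hx
  simp [hx]

/-- `f ≤ g` a.e. with equal integrals are a.e. equal. -/
theorem ae_eq_of_le (hf : Bb f) (hg : Bb g) (h : ∀ x, f x ≤ g x)
    (hi : ∫ x, g x ∂μ ≤ ∫ x, f x ∂μ) : f =ᵐ[μ] g := by
  have h0 : ∫ x, (g x - f x) ∂μ = 0 := by
    apply le_antisymm
    · rw [integral_sub (bb_int μ hg) (bb_int μ hf)]; linarith
    · exact integral_nonneg fun x => sub_nonneg.2 (h x)
  have := (integral_eq_zero_iff_of_nonneg (fun x => sub_nonneg.2 (h x))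
    (bb_int μ (bb_sub hg hf))).1 h0
  filter_upwards [this] with x hx
  simp only [Pi.zero_apply] at hx
  linarith

theorem N_tendsto_of_pointwise {F : ℕ → Ω → ℝ} {C : ℝ} (hF : ∀ n, Bb (F n)) (hg : Bb g)
    (hC : ∀ n x, |F n x| ≤ C)
    (h : ∀ᵐ x ∂μ, Tendsto (fun n => F n x) atTop (𝓝 (g x))) :
    Tendsto (fun n => N μ (F n - g)) atTop (𝓝 0) := by
  obtain ⟨hgm, D, hD⟩ := id hg
  have := tendsto_integral_of_dominated_convergence (μ := μ) (F := fun n x => |F n x - g x|)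
    (f := fun _ => 0) (fun _ => C + D)
    (fun n => (bb_abs (bb_sub (hF n) hg)).1.aestronglyMeasurable) (integrable_const _)
    (fun n => Eventually.of_forall fun x => by
      simp only [Real.norm_eq_abs, abs_abs]
      exact (abs_sub _ _).trans (add_le_add (hC n x) (hD x)))
    (by
      filter_upwards [h] with x hx
      have := (hx.sub_const (g x)).abs
      simpa using this)
  simpa [N] using this

theorem integral_tendsto_of_N {F : ℕ → Ω → ℝ} (hF : ∀ n, Bb (F n)) (hg : Bb g)
    (h : Tendsto (fun n => N μ (F n - g)) atTop (𝓝 0)) :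
    Tendsto (fun n => ∫ x, F n x ∂μ) atTop (𝓝 (∫ x, g x ∂μ)) := by
  rw [tendsto_iff_norm_sub_tendsto_zero]
  refine squeeze_zero (fun _ => norm_nonneg _) (fun n => ?_) h
  rw [← integral_sub (bb_int μ (hF n)) (bb_int μ hg)]
  exact norm_integral_le_integral_norm _

theorem exists_ae_subseq {F : ℕ → Ω → ℝ} (hF : ∀ n, Bb (F n))
    (h : Tendsto (fun n => N μ (F n)) atTop (𝓝 0)) :
    ∃ φ : ℕ → ℕ, StrictMono φ ∧ ∀ᵐ x ∂μ, Tendsto (fun n => F (φ n) x) atTop (𝓝 0) := by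
  have h1 : TendstoInMeasure μ F atTop (fun _ => (0 : ℝ)) := by
    refine tendstoInMeasure_of_tendsto_eLpNorm (p := 1) one_ne_zero
      (fun n => (hF n).1.aestronglyMeasurable) aestronglyMeasurable_const ?_
    have h2 : ∀ n, eLpNorm (F n - fun _ => (0 : ℝ)) 1 μ = ENNReal.ofReal (N μ (F n)) := by
      intro n
      have : (F n - fun _ => (0 : ℝ)) = F n := by ext; simp
      rw [this, eLpNorm_one_eq_lintegral_enorm, N,
        ← ofReal_integral_norm_eq_lintegral_enorm (bb_int μ (hF n))]
      simp [Real.norm_eq_abs]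
    simp_rw [h2]
    simpa using ENNReal.tendsto_ofReal h
  exact h1.exists_seq_tendsto_ae

/-- Weak-* sequential compactness of bounded sequences in `L^∞`. -/
theorem weak_star_subseq [TopologicalSpace Ω] [SecondCountableTopology Ω] [BorelSpace Ω]
    {F : ℕ → Ω → ℝ} {C : ℝ} (hC0 : 0 ≤ C) (hF : ∀ n, Measurable (F n)) (hC : ∀ n x, |F n x| ≤ C) :
    ∃ φ : ℕ → ℕ, StrictMono φ ∧ ∀ q : Ω → ℝ, Integrable q μ →
      ∃ l : ℝ, Tendsto (fun n => ∫ x, F (φ n) x * q x ∂μ) atTop (𝓝 l) := by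
  have hint : ∀ n (q : Ω → ℝ), Integrable q μ → Integrable (fun x => F n x * q x) μ := by
    intro n q hq
    exact hq.bdd_mul (hF n).aestronglyMeasurable (Eventually.of_forall (hC n))
  have hbd : ∀ n (q : Lp ℝ 1 μ), ‖∫ x, F n x * q x ∂μ‖ ≤ C * ‖q‖ := by
    intro n q
    refine (norm_integral_le_integral_norm _).trans ?_
    rw [L1.norm_eq_integral_norm, ← integral_const_mul]
    refine integral_mono (hint n _ (L1.integrable_coeFn q)).norm
      ((L1.integrable_coeFn q).norm.const_mul C) fun x => ?_
    simp only [norm_mul]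
    exact mul_le_mul_of_nonneg_right (hC n x) (norm_nonneg _)
  let ℓ : ℕ → StrongDual ℝ (Lp ℝ 1 μ) := fun n =>
    LinearMap.mkContinuous
      { toFun := fun q => ∫ x, F n x * q x ∂μ
        map_add' := by
          intro p q
          rw [← integral_add (hint n _ (L1.integrable_coeFn p)) (hint n _ (L1.integrable_coeFn q))]
          refine integral_congr_ae ?_
          filter_upwards [Lp.coeFn_add p q] with x hx
          rw [hx, Pi.add_apply, mul_add]
        map_smul' := by
          intro c q
          simp only [RingHom.id_apply, smul_eq_mul]
          rw [← integral_const_mul]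
          refine integral_congr_ae ?_
          filter_upwards [Lp.coeFn_smul c q] with x hx
          rw [hx, Pi.smul_apply, smul_eq_mul]; ring } C (by
        intro q
        simp only [LinearMap.coe_mk, AddHom.coe_mk]
        exact hbd n q)
  have hℓ : ∀ n (q : Lp ℝ 1 μ), ℓ n q = ∫ x, F n x * q x ∂μ := fun n q => rfl
  have : Fact ((1 : ENNReal) ≠ ⊤) := ⟨ENNReal.one_ne_top⟩
  have : TopologicalSpace.SeparableSpace (Lp ℝ 1 μ) := inferInstance
  obtain ⟨L, -, φ, hφ, hL⟩ := (WeakDual.isSeqCompact_closedBall (𝕜 := ℝ) (E := Lp ℝ 1 μ) 0 C)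
    (x := fun n => StrongDual.toWeakDual (ℓ n)) (fun n => by
      simp only [mem_preimage, mem_closedBall_zero_iff]
      refine ContinuousLinearMap.opNorm_le_bound _ hC0 fun q => ?_
      change ‖ℓ n q‖ ≤ _
      rw [hℓ]
      exact hbd n q)
  refine ⟨φ, hφ, fun q hq => ?_⟩
  have h1 := (WeakDual.eval_continuous (𝕜 := ℝ) (hq.toL1 q)).tendsto L |>.comp hL
  refine ⟨_, h1.congr fun n => ?_⟩
  change ℓ (φ n) (hq.toL1 q) = _
  rw [hℓ]
  refine integral_congr_ae ?_
  filter_upwards [hq.coeFn_toL1] with x hx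
  rw [hx]

end basics

section semigroup

variable {Ω : Type*} [TopologicalSpace Ω] [T2Space Ω] [SecondCountableTopology Ω]
    [MeasurableSpace Ω] [BorelSpace Ω]

/-- All the hypotheses of the theorem. -/
structure Hyp (μ : Measure Ω) (T : ℝ → (Ω → ℝ) → (Ω → ℝ)) (M : ℝ) : Prop where
  hμpos : ∀ U : Set Ω, IsOpen U → U.Nonempty → 0 < μ U
  hTBb : ∀ t, 0 ≤ t → ∀ f, Bb f → Bb (T t f)
  hadd : ∀ t, 0 ≤ t → ∀ f g, Bb f → Bb g → T t (f + g) = T t f + T t g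
  hsmul : ∀ t, 0 ≤ t → ∀ (c : ℝ) (f), Bb f → T t (c • f) = c • T t f
  hpos : ∀ t, 0 ≤ t → ∀ f, Bb f → (∀ x, 0 ≤ f x) → ∀ x, 0 ≤ T t f x
  hT0 : ∀ f, Bb f → T 0 f = f
  hsg : ∀ s t : ℝ, 0 ≤ s → 0 ≤ t → ∀ f, Bb f → T (s + t) f = T s (T t f)
  hSF : ∀ t, 0 < t → ∀ f, Bb f → Continuous (T t f)
  hbdd : ∀ t, 0 ≤ t → ∀ f, Bb f → (∀ x, |f x| ≤ 1) → ∀ x, |T t f x| ≤ M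
  hdelta : ∀ t, 0 < t → ∀ x : Ω, ∃ ν : Measure Ω, IsFiniteMeasure ν ∧
      ∀ f, Bb f → T t f x = ∫ y, f y ∂ν
  hinv : ∀ t, 0 ≤ t → ∀ f, Bb f → ∫ x, T t f x ∂μ = ∫ x, f x ∂μ
  hirr : ∀ B : Set Ω, MeasurableSet B →
      (∀ t, 0 ≤ t → ∀ f, Bb f → (∀ᵐ x ∂μ, x ∉ B → f x = 0) →
        ∀ᵐ x ∂μ, x ∉ B → T t f x = 0) → μ B = 0 ∨ μ Bᶜ = 0
  hcont : ∀ f, Bb f →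
      Tendsto (fun t => ∫ x, |T t f x - f x| ∂μ) (nhdsWithin 0 (Ioi 0)) (nhds 0)

variable {μ : Measure Ω} [IsFiniteMeasure μ] {T : ℝ → (Ω → ℝ) → (Ω → ℝ)} {M : ℝ}

namespace Hyp

variable {f g : Ω → ℝ} {t : ℝ}

theorem cont_eq (H : Hyp μ T M) (hf : Continuous f) (hg : Continuous g) (h : f =ᵐ[μ] g) : f = g := by
  have : μ.IsOpenPosMeasure := ⟨fun U hU hne => (H.hμpos U hU hne).ne'⟩
  exact (Continuous.ae_eq_iff_eq μ hf hg).1 h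

theorem T_sub (H : Hyp μ T M) (ht : 0 ≤ t) (hf : Bb f) (hg : Bb g) : T t (f - g) = T t f - T t g := by
  have h1 : f - g = f + (-1 : ℝ) • g := by ext x; simp [sub_eq_add_neg]
  rw [h1, H.hadd t ht _ _ hf (bb_smul _ hg), H.hsmul t ht _ _ hg]
  ext x; simp [sub_eq_add_neg]

theorem T_mono (H : Hyp μ T M) (ht : 0 ≤ t) (hf : Bb f) (hg : Bb g) (h : ∀ x, f x ≤ g x) (x : Ω) :
    T t f x ≤ T t g x := by
  have := H.hpos t ht (g - f) (bb_sub hg hf) (fun x => sub_nonneg.2 (h x)) x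
  rw [H.T_sub ht hg hf] at this
  exact sub_nonneg.1 this

theorem T_abs (H : Hyp μ T M) (ht : 0 ≤ t) (hf : Bb f) (x : Ω) : |T t f x| ≤ T t (fun y => |f y|) x := by
  rw [abs_le]
  constructor
  · have h1 := H.T_mono ht (bb_smul (-1) (bb_abs hf)) hf (fun x => by
      simpa using neg_abs_le (f x)) x
    rw [H.hsmul t ht _ _ (bb_abs hf)] at h1
    simpa using h1
  · exact H.T_mono ht hf (bb_abs hf) (fun x => le_abs_self _) x

theorem T_bound (H : Hyp μ T M) (ht : 0 ≤ t) (hf : Bb f) {C : ℝ} (hC : ∀ x, |f x| ≤ C) (x : Ω) :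
    |T t f x| ≤ C * M := by
  have hC0 : 0 ≤ C := (abs_nonneg _).trans (hC x)
  have hb : Bb (fun _ : Ω => (1 : ℝ)) := bb_const 1
  have h1 := H.T_mono ht (bb_abs hf) (bb_smul C hb) (fun y => by simpa using hC y) x
  rw [H.hsmul t ht _ _ hb] at h1
  have h2 := H.hbdd t ht _ hb (fun x => by simp) x
  calc |T t f x| ≤ _ := H.T_abs ht hf x
    _ ≤ _ := h1
    _ ≤ C * M := by
      simp only [Pi.smul_apply, smul_eq_mul]
      exact mul_le_mul_of_nonneg_left ((le_abs_self _).trans h2) hC0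

theorem N_T (H : Hyp μ T M) (ht : 0 ≤ t) (hf : Bb f) : N μ (T t f) ≤ N μ f := by
  have hT := H.hTBb t ht f hf
  have := H.hinv t ht _ (bb_abs hf)
  unfold N
  rw [← this]
  exact integral_mono (bb_int μ (bb_abs hT)) (bb_int μ (H.hTBb t ht _ (bb_abs hf)))
    (H.T_abs ht hf)

theorem N_T_sub (H : Hyp μ T M) (ht : 0 ≤ t) (hf : Bb f) (hg : Bb g) : N μ (T t f - T t g) ≤ N μ (f - g) := by
  rw [← H.T_sub ht hf hg]
  exact H.N_T ht (bb_sub hf hg)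

/-- absolutely continuous kernels -/
theorem kernel (H : Hyp μ T M) (ht : 0 < t) (x : Ω) : ∃ ν : Measure Ω, IsFiniteMeasure ν ∧ ν ≪ μ ∧
    ∀ f, Bb f → T t f x = ∫ y, f y ∂ν := by
  obtain ⟨ν, hν, h⟩ := H.hdelta t ht x
  refine ⟨ν, hν, ?_, h⟩
  refine Measure.AbsolutelyContinuous.mk fun A hA hA0 => ?_
  have hb : Bb (A.indicator (fun _ => (1 : ℝ))) := by
    refine ⟨measurable_const.indicator hA, 1, fun x => ?_⟩
    by_cases hx : x ∈ A <;> simp [hx]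
  have h1 : N μ (T t (A.indicator fun _ => (1 : ℝ))) = 0 := by
    apply le_antisymm _ (N_nonneg μ _)
    refine (H.N_T ht.le hb).trans (le_of_eq ?_)
    rw [N_eq_zero μ hb]
    have : ∀ᵐ x ∂μ, x ∉ A := measure_eq_zero_iff_ae_notMem.1 hA0
    filter_upwards [this] with x hx
    simp [hx]
  have h2 := (N_eq_zero μ (H.hTBb t ht.le _ hb)).1 h1
  have h3 := H.cont_eq (H.hSF t ht _ hb) (g := 0) continuous_zero h2
  have h4 := h _ hb
  rw [h3, integral_indicator_const _ hA] at h4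
  simp only [Pi.zero_apply, smul_eq_mul, mul_one] at h4
  have := h4.symm
  rwa [measureReal_eq_zero_iff] at this

theorem T_congr (H : Hyp μ T M) (ht : 0 < t) (hf : Bb f) (hg : Bb g) (h : f =ᵐ[μ] g) : T t f = T t g := by
  ext x
  obtain ⟨ν, hν, hac, h1⟩ := H.kernel ht x
  rw [h1 _ hf, h1 _ hg]
  exact integral_congr_ae (hac.ae_eq h)

/-- Compactness: `T t` maps bounded sequences to sequences with pointwise convergent
subsequences. -/
theorem compact (H : Hyp μ T M) (ht : 0 < t) {F : ℕ → Ω → ℝ} {C : ℝ} (hF : ∀ n, Bb (F n))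
    (hC : ∀ n x, |F n x| ≤ C) : ∃ (φ : ℕ → ℕ) (g : Ω → ℝ), StrictMono φ ∧ Bb g ∧
      (∀ x, |g x| ≤ C * M) ∧ (∀ x, Tendsto (fun n => T t (F (φ n)) x) atTop (𝓝 (g x))) ∧
      Tendsto (fun n => N μ (T t (F (φ n)) - g)) atTop (𝓝 0) := by
  obtain ⟨φ, hφ, h⟩ := weak_star_subseq μ (abs_nonneg C) (fun n => (hF n).1)
    (fun n x => (hC n x).trans (le_abs_self C))
  have h1 : ∀ x, ∃ l, Tendsto (fun n => T t (F (φ n)) x) atTop (𝓝 l) := by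
    intro x
    obtain ⟨ν, hν, hac, h1⟩ := H.kernel ht x
    obtain ⟨l, hl⟩ := h (fun y => (ν.rnDeriv μ y).toReal) Measure.integrable_toReal_rnDeriv
    refine ⟨l, hl.congr fun n => ?_⟩
    rw [h1 _ (hF _), ← integral_rnDeriv_smul hac]
    simp only [smul_eq_mul, mul_comm]
  choose g hg using h1
  have hb : ∀ n x, |T t (F (φ n)) x| ≤ C * M := fun n x => H.T_bound ht.le (hF _) (hC _) x
  have hgb : ∀ x, |g x| ≤ C * M := fun x => le_of_tendsto (hg x).abs
    (Eventually.of_forall fun n => hb n x)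
  have hgB : Bb g := by
    refine ⟨measurable_of_tendsto_metrizable (fun n => (H.hTBb t ht.le _ (hF (φ n))).1)
      (tendsto_pi_nhds.2 hg), _, hgb⟩
  exact ⟨φ, g, hφ, hgB, hgb, hg, N_tendsto_of_pointwise μ (fun n => H.hTBb t ht.le _ (hF (φ n)))
    hgB hb (Eventually.of_forall hg)⟩

theorem unif_subseq (H : Hyp μ T M) (ht : 0 < t) {F : ℕ → Ω → ℝ} {C : ℝ} (hF : ∀ n, Bb (F n))
    (hC : ∀ n x, |F n x| ≤ C) (h : Tendsto (fun n => N μ (F n)) atTop (𝓝 0))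
    {K : Set Ω} (hK : IsCompact K) : ∃ φ : ℕ → ℕ, StrictMono φ ∧
      TendstoUniformlyOn (fun n x => T t (F (φ n)) x) (fun _ => 0) atTop K := by
  obtain ⟨φ, hφ, hae⟩ := exists_ae_subseq μ hF h
  refine ⟨φ, hφ, ?_⟩
  let G : ℕ → Ω → ℝ := fun n x => ⨆ m, |F (φ (n + m)) x|
  have hbdd : ∀ n x, BddAbove (range fun m => |F (φ (n + m)) x|) := by
    intro n x
    refine ⟨C, ?_⟩
    rintro _ ⟨m, rfl⟩
    exact hC _ _
  have hG0 : ∀ n x, 0 ≤ G n x := fun n x => Real.iSup_nonneg fun m => abs_nonneg _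
  have hGC : ∀ n x, G n x ≤ C := fun n x => ciSup_le fun m => hC _ _
  have hGle : ∀ n x, |F (φ n) x| ≤ G n x := fun n x => le_ciSup (hbdd n x) 0
  have hGB : ∀ n, Bb (G n) := by
    intro n
    refine ⟨Measurable.iSup fun m => (bb_abs (hF _)).1, C, fun x => ?_⟩
    rw [abs_of_nonneg (hG0 n x)]
    exact hGC n x
  have hanti : ∀ x, Antitone (fun n => G n x) := by
    intro x n m hnm
    refine ciSup_le fun k => ?_
    have := le_ciSup (hbdd n x) (m - n + k)
    simpa [← add_assoc, Nat.add_sub_cancel' hnm] using this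
  have hGt : ∀ᵐ x ∂μ, Tendsto (fun n => G n x) atTop (𝓝 0) := by
    filter_upwards [hae] with x hx
    rw [Metric.tendsto_atTop] at hx ⊢
    intro ε hε
    obtain ⟨n0, hn0⟩ := hx (ε / 2) (by positivity)
    refine ⟨n0, fun n hn => ?_⟩
    rw [Real.dist_eq, sub_zero, abs_of_nonneg (hG0 n x)]
    refine lt_of_le_of_lt (ciSup_le fun m => ?_) (half_lt_self hε)
    have := hn0 (n + m) (by omega)
    rw [Real.dist_eq, sub_zero] at this
    exact this.le
  have hpt : ∀ x, Tendsto (fun n => T t (G n) x) atTop (𝓝 0) := by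
    intro x
    obtain ⟨ν, hν, hac, h1⟩ := H.kernel ht x
    simp_rw [h1 _ (hGB _)]
    have := tendsto_integral_of_dominated_convergence (μ := ν) (F := G) (f := fun _ => 0)
      (fun _ => C) (fun n => (hGB n).1.aestronglyMeasurable) (integrable_const _)
      (fun n => Eventually.of_forall fun x => by
        rw [Real.norm_eq_abs, abs_of_nonneg (hG0 n x)]; exact hGC n x)
      (hac.ae_le hGt)
    simpa using this
  have hD := Antitone.tendstoUniformlyOn_of_forall_tendsto (F := fun n => T t (G n))
    (f := fun _ => (0 : ℝ)) hK (fun n => (H.hSF t ht _ (hGB n)).continuousOn)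
    (fun x _ n m hnm => H.T_mono ht.le (hGB m) (hGB n) (fun y => hanti y hnm) x)
    continuousOn_const (fun x _ => hpt x)
  rw [Metric.tendstoUniformlyOn_iff] at hD ⊢
  intro ε hε
  filter_upwards [hD ε hε] with n hn x hx
  have h1 := hn x hx
  rw [Real.dist_eq, zero_sub, abs_neg] at h1 ⊢
  refine lt_of_le_of_lt ?_ h1
  calc _ ≤ _ := H.T_abs ht.le (hF _) x
    _ ≤ T t (G n) x := H.T_mono ht.le (bb_abs (hF _)) (hGB n) (hGle n) x
    _ ≤ _ := le_abs_self _

theorem unif0 (H : Hyp μ T M) (ht : 0 < t) {F : ℕ → Ω → ℝ} {C : ℝ} (hF : ∀ n, Bb (F n))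
    (hC : ∀ n x, |F n x| ≤ C) (h : Tendsto (fun n => N μ (F n)) atTop (𝓝 0))
    {K : Set Ω} (hK : IsCompact K) :
      TendstoUniformlyOn (fun n x => T t (F n) x) (fun _ => 0) atTop K := by
  rw [Metric.tendstoUniformlyOn_iff]
  by_contra hcon
  push Not at hcon
  obtain ⟨ε, hε, hfr⟩ := hcon
  obtain ⟨ψ, hψ, hψ2⟩ := extraction_of_frequently_atTop hfr
  obtain ⟨φ, hφ, hu⟩ := H.unif_subseq ht (F := fun n => F (ψ n)) (fun n => hF _) (fun n => hC _)
    (h.comp hψ.tendsto_atTop) hK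
  rw [Metric.tendstoUniformlyOn_iff] at hu
  obtain ⟨n, hn⟩ := (hu ε hε).exists
  obtain ⟨x, hx, hx2⟩ := hψ2 (φ n)
  exact absurd (hn x hx) (not_lt.2 hx2)

theorem pointwise (H : Hyp μ T M) (ht : 0 < t) {F : ℕ → Ω → ℝ} {C : ℝ} (hF : ∀ n, Bb (F n)) (hg : Bb g)
    (hC : ∀ n x, |F n x| ≤ C) (h : Tendsto (fun n => N μ (F n - g)) atTop (𝓝 0)) (x : Ω) :
    Tendsto (fun n => T t (F n) x) atTop (𝓝 (T t g x)) := by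
  obtain ⟨D, hD⟩ := hg.2
  have := (H.unif0 ht (F := fun n => F n - g) (C := C + D) (fun n => bb_sub (hF n) hg)
    (fun n x => (abs_sub _ _).trans (add_le_add (hC n x) (hD x))) h
    (isCompact_singleton (x := x))).tendsto_at (mem_singleton x)
  simp_rw [H.T_sub ht.le (hF _) hg] at this
  have h2 := this.add_const (T t g x)
  simpa using h2




theorem invariant (H : Hyp μ T M) (he : Bb f) (he0 : ∀ x, 0 ≤ f x) (hfix : ∀ t, 0 ≤ t → T t f = f) :
    f =ᵐ[μ] 0 ∨ ∀ᵐ x ∂μ, 0 < f x := by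
  have hm : MeasurableSet {x | 0 < f x} := measurableSet_lt measurable_const he.1
  rcases H.hirr {x | 0 < f x} hm (by
    intro t ht g hg h
    rcases ht.eq_or_lt with rfl | ht'
    · rw [H.hT0 g hg]; exact h
    · refine Eventually.of_forall fun x hx => ?_
      obtain ⟨ν, hν, hac, h1⟩ := H.kernel ht' x
      have h2 : f x = 0 := le_antisymm (not_lt.1 hx) (he0 x)
      have h3 : ∫ y, f y ∂ν = 0 := by rw [← h1 f he, hfix t ht, h2]
      have h4 := (integral_eq_zero_iff_of_nonneg he0 (bb_int ν he)).1 h3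
      rw [h1 g hg]
      refine integral_eq_zero_of_ae ?_
      filter_upwards [h4, hac.ae_le h] with y hy1 hy2
      exact hy2 (by simp only [not_lt]; exact hy1.le)) with h | h
  · left
    have := measure_eq_zero_iff_ae_notMem.1 h
    filter_upwards [this] with x hx
    exact le_antisymm (not_lt.1 hx) (he0 x)
  · right
    have := measure_eq_zero_iff_ae_notMem.1 h
    filter_upwards [this] with x hx
    simpa using hx

/-- a fixed function with zero integral vanishes -/
theorem fix_zero (H : Hyp μ T M) (hμ : μ ≠ 0) (hg : Bb g) (hfix : ∀ t, 0 ≤ t → T t g = g)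
    (hint : ∫ x, g x ∂μ = 0) : g = 0 := by
  have hgc : Continuous g := by
    have := H.hSF 1 one_pos g hg
    rwa [hfix 1 zero_le_one] at this
  have habs : ∀ t, 0 ≤ t → T t (fun x => |g x|) = fun x => |g x| := by
    intro t ht
    rcases ht.eq_or_lt with rfl | ht'
    · exact H.hT0 _ (bb_abs hg)
    · symm
      refine H.cont_eq hgc.abs (H.hSF t ht' _ (bb_abs hg)) ?_
      refine ae_eq_of_le μ (bb_abs hg) (H.hTBb t ht _ (bb_abs hg)) (fun x => ?_)
        (H.hinv t ht _ (bb_abs hg)).le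
      have := H.T_abs ht hg x
      rwa [hfix t ht] at this
  have hP : Bb ((fun x => |g x|) + g) := bb_add (bb_abs hg) hg
  have hPf : ∀ t, 0 ≤ t → T t ((fun x => |g x|) + g) = (fun x => |g x|) + g := by
    intro t ht
    rw [H.hadd t ht _ _ (bb_abs hg) hg, habs t ht, hfix t ht]
  refine H.cont_eq hgc continuous_zero ?_
  rcases H.invariant hP (fun x => by
    simp only [Pi.add_apply]; linarith [neg_abs_le (g x)]) hPf with h | h
  · have h1 : ∀ᵐ x ∂μ, 0 ≤ -g x := by
      filter_upwards [h] with x hx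
      simp only [Pi.add_apply, Pi.zero_apply] at hx
      linarith [abs_nonneg (g x)]
    have h2 : ∫ x, -g x ∂μ = 0 := by rw [integral_neg, hint, neg_zero]
    have h3 := (integral_eq_zero_iff_of_nonneg_ae h1 (bb_int μ hg).neg).1 h2
    filter_upwards [h3] with x hx
    simpa using hx
  · have h1 : ∀ᵐ x ∂μ, 0 < g x := by
      filter_upwards [h] with x hx
      simp only [Pi.add_apply] at hx
      by_contra hcon
      rw [abs_of_nonpos (not_lt.1 hcon)] at hx
      linarith
    have h3 := (integral_eq_zero_iff_of_nonneg_ae (h1.mono fun x hx => hx.le) (bb_int μ hg)).1 hint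
    exact h3

theorem fix_span (H : Hyp μ T M) (hμ : μ ≠ 0) {e : Ω → ℝ} (he : Bb e) (hefix : ∀ t, 0 ≤ t → T t e = e)
    (heint : ∫ x, e x ∂μ = 1) (hf : Bb f) (hfix : ∀ t, 0 ≤ t → T t f = f) :
    ∀ x, f x = (∫ x, f x ∂μ) * e x := by
  have := H.fix_zero hμ (g := f - (∫ x, f x ∂μ) • e) (bb_sub hf (bb_smul _ he)) (by
    intro t ht
    rw [H.T_sub ht hf (bb_smul _ he), H.hsmul t ht _ _ he, hfix t ht, hefix t ht]) (by
    simp only [Pi.sub_apply, Pi.smul_apply, smul_eq_mul]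
    rw [integral_sub (bb_int μ hf) ((bb_int μ he).const_mul _), integral_const_mul, heint]
    ring)
  intro x
  have h := congrFun this x
  simp only [Pi.sub_apply, Pi.smul_apply, smul_eq_mul, Pi.zero_apply] at h
  linarith

theorem T_sum (H : Hyp μ T M) (ht : 0 ≤ t) (m : ℕ) {F : ℕ → Ω → ℝ} (hF : ∀ i, Bb (F i)) :
    T t (∑ i ∈ Finset.range m, F i) = ∑ i ∈ Finset.range m, T t (F i) := by
  induction m with
  | zero =>
    have := H.hsmul t ht 0 (fun _ => 0) (bb_const 0)
    simp only [zero_smul] at this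
    simpa using this
  | succ m ih =>
    rw [Finset.sum_range_succ, Finset.sum_range_succ, H.hadd t ht _ _ (bb_sum _ hF) (hF m), ih]

theorem cesaro (H : Hyp μ T M) (hM : 0 ≤ M) (δ : ℝ) (hδ : 0 < δ) (m : ℕ) (hm : 0 < m) : ∃ c : Ω → ℝ, Bb c ∧
    (∀ x, 0 ≤ c x) ∧ (∀ x, |c x| ≤ M) ∧ (∫ x, c x ∂μ = μ.real univ) ∧
    ∀ p : ℕ, ∀ x, |(T (p * δ) c - c) x| ≤ 2 * p * M / m := by
  have h1 : Bb (fun _ : Ω => (1 : ℝ)) := bb_const 1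
  let a : ℕ → Ω → ℝ := fun n => T (n * δ) (fun _ => 1)
  have hn : ∀ n : ℕ, (0 : ℝ) ≤ n * δ := fun n => by positivity
  have ha : ∀ n, Bb (a n) := fun n => H.hTBb _ (hn n) _ h1
  have ha0 : ∀ n x, 0 ≤ a n x := fun n x => H.hpos _ (hn n) _ h1 (fun _ => zero_le_one) x
  have haM : ∀ n x, |a n x| ≤ M := fun n x => H.hbdd _ (hn n) _ h1 (fun _ => by simp) x
  have haM' : ∀ n x, a n x ≤ M := fun n x => (le_abs_self _).trans (haM n x)
  have hai : ∀ n, ∫ x, a n x ∂μ = μ.real univ := fun n => by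
    rw [H.hinv _ (hn n) _ h1]; simp
  have hm' : (0 : ℝ) < m := by exact_mod_cast hm
  have hSB := bb_sum (Finset.range m) ha
  have hc0 : ∀ x, 0 ≤ ((m : ℝ)⁻¹ • ∑ i ∈ Finset.range m, a i) x := by
    intro x
    simp only [Pi.smul_apply, Finset.sum_apply, smul_eq_mul]
    exact mul_nonneg (by positivity) (Finset.sum_nonneg fun i _ => ha0 i x)
  refine ⟨(m : ℝ)⁻¹ • ∑ i ∈ Finset.range m, a i, bb_smul _ hSB, hc0, ?_, ?_, ?_⟩
  · intro x
    rw [abs_of_nonneg (hc0 x)]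
    simp only [Pi.smul_apply, Finset.sum_apply, smul_eq_mul]
    have : ∑ i ∈ Finset.range m, a i x ≤ ∑ i ∈ Finset.range m, M :=
      Finset.sum_le_sum fun i _ => haM' i x
    rw [Finset.sum_const, Finset.card_range, nsmul_eq_mul] at this
    rw [inv_mul_le_iff₀ hm']
    exact this
  · simp only [Pi.smul_apply, Finset.sum_apply, smul_eq_mul]
    rw [integral_const_mul, integral_finsetSum _ (fun i _ => bb_int μ (ha i))]
    simp only [hai, Finset.sum_const, Finset.card_range, nsmul_eq_mul]
    field_simp
  · intro p x
    have hshift : ∀ i, T (p * δ) (a i) = a (p + i) := by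
      intro i
      change T (p * δ) (T (i * δ) _) = T (((p + i : ℕ) : ℝ) * δ) _
      rw [← H.hsg _ _ (hn p) (hn i) _ h1]
      push_cast
      rw [add_mul]
    rw [H.hsmul _ (hn p) _ _ hSB, H.T_sum (hn p) m ha]
    simp only [hshift]
    have e1 : ∑ i ∈ Finset.range m, a (p + i) + ∑ i ∈ Finset.range p, a i
        = ∑ i ∈ Finset.range p, a (m + i) + ∑ i ∈ Finset.range m, a i := by
      have A := Finset.sum_range_add a p m
      have B := Finset.sum_range_add a m p
      rw [add_comm p m] at A
      rw [A] at B
      rw [add_comm, B, add_comm]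
    have e2 := congrFun e1 x
    simp only [Pi.add_apply, Finset.sum_apply] at e2
    simp only [Pi.sub_apply, Pi.smul_apply, Finset.sum_apply, smul_eq_mul]
    rw [← mul_sub, abs_mul, abs_of_pos (inv_pos.2 hm'), inv_mul_le_iff₀ hm']
    have e3 : ∑ i ∈ Finset.range m, a (p + i) x - ∑ i ∈ Finset.range m, a i x
      = ∑ i ∈ Finset.range p, a (m + i) x - ∑ i ∈ Finset.range p, a i x := by linarith
    rw [e3]
    have b1 : ∑ i ∈ Finset.range p, a (m + i) x ≤ p * M := by
      have := Finset.sum_le_sum (s := Finset.range p) fun i _ => haM' (m + i) x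
      simpa using this
    have b2 : ∑ i ∈ Finset.range p, a i x ≤ p * M := by
      have := Finset.sum_le_sum (s := Finset.range p) fun i _ => haM' i x
      simpa using this
    have b3 : 0 ≤ ∑ i ∈ Finset.range p, a (m + i) x := Finset.sum_nonneg fun i _ => ha0 _ x
    have b4 : 0 ≤ ∑ i ∈ Finset.range p, a i x := Finset.sum_nonneg fun i _ => ha0 _ x
    have b5 : (m : ℝ) * (2 * p * M / m) = 2 * p * M := by field_simp
    rw [b5, abs_le]
    have : (0 : ℝ) ≤ p * M := by positivity
    constructor <;> nlinarith

theorem cont_seq (H : Hyp μ T M) (hf : Bb f) {s : ℕ → ℝ} (hs0 : ∀ n, 0 ≤ s n) (hs : Tendsto s atTop (𝓝 0)) :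
    Tendsto (fun n => N μ (T (s n) f - f)) atTop (𝓝 0) := by
  have h1 : Tendsto (fun t => N μ (T t f - f)) (𝓝[≥] 0) (𝓝 0) := by
    rw [← Ioi_insert, nhdsWithin_insert, tendsto_sup]
    refine ⟨?_, H.hcont f hf⟩
    rw [tendsto_pure_left]
    intro s hs
    rw [H.hT0 f hf]
    have : N μ (f - f) = 0 := by simp [N]
    rw [this]
    exact mem_of_mem_nhds hs
  exact h1.comp (tendsto_nhdsWithin_iff.2 ⟨hs, Eventually.of_forall hs0⟩)

theorem exists_fix (H : Hyp μ T M) (hμ : μ ≠ 0) : ∃ e : Ω → ℝ, Bb e ∧ (∀ x, 0 ≤ e x) ∧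
    (∀ t, 0 ≤ t → T t e = e) ∧ ∫ x, e x ∂μ = 1 := by
  have hne : Nonempty Ω := by
    by_contra h
    rw [not_nonempty_iff] at h
    exact hμ (Measure.eq_zero_of_isEmpty μ)
  obtain ⟨x0⟩ := hne
  have hM : 0 ≤ M := (abs_nonneg _).trans (H.hbdd 0 le_rfl _ (bb_const 1) (fun _ => by simp) x0)
  have hk : ∀ k : ℕ, (0 : ℝ) < 1 / ((k : ℝ) + 1) := fun k => by positivity
  choose c hcB hc0 hcM hci hcs using fun k : ℕ =>
    H.cesaro hM (1 / ((k : ℝ) + 1)) (hk k) ((k + 1) ^ 2) (by positivity)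
  obtain ⟨φ, g, hφ, hgB, hgb, hgp, hgN⟩ := H.compact one_pos hcB hcM
  have hB1 : ∀ k, Bb (T 1 (c k)) := fun k => H.hTBb 1 zero_le_one _ (hcB k)
  have hg0 : ∀ x, 0 ≤ g x := fun x => ge_of_tendsto' (hgp x) fun n =>
    H.hpos 1 zero_le_one _ (hcB _) (hc0 _) x
  have hgi : ∫ x, g x ∂μ = μ.real univ := by
    refine tendsto_nhds_unique (integral_tendsto_of_N μ (fun n => hB1 (φ n)) hgB hgN) ?_
    simp_rw [H.hinv 1 zero_le_one _ (hcB _), hci]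
    exact tendsto_const_nhds
  have hfix : ∀ s, 0 ≤ s → T s g =ᵐ[μ] g := by
    intro s hs
    have hTg := H.hTBb s hs g hgB
    refine ae_eq_of_N μ hTg hgB ?_
    apply le_antisymm _ (N_nonneg μ _)
    let p : ℕ → ℕ := fun k => ⌊s * (k + 1)⌋₊
    let σ : ℕ → ℝ := fun k => p k * (1 / ((k : ℝ) + 1))
    have hσ0 : ∀ k, 0 ≤ σ k := fun k => by positivity
    have hpu : ∀ k, (p k : ℝ) ≤ s * (k + 1) := fun k => Nat.floor_le (by positivity)
    have hpl : ∀ k, s * (k + 1) < p k + 1 := fun k => Nat.lt_floor_add_one _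
    have hσs : ∀ k, σ k ≤ s := fun k => by
      have := hpu k
      simp only [σ, mul_one_div]
      rw [div_le_iff₀ (by positivity)]
      exact this
    have hσt : Tendsto (fun k => s - σ k) atTop (𝓝 0) := by
      refine squeeze_zero (fun k => sub_nonneg.2 (hσs k)) (fun k => ?_)
        tendsto_one_div_add_atTop_nhds_zero_nat
      have := hpl k
      simp only [σ, mul_one_div]
      rw [sub_le_iff_le_add, ← add_div, le_div_iff₀ (by positivity)]
      linarith
    have key : ∀ n, N μ (T s g - g) ≤ N μ (T (s - σ (φ n)) g - g) + N μ (T 1 (c (φ n)) - g)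
        + 2 * s * M * μ.real univ * (1 / ((φ n : ℝ) + 1)) + N μ (T 1 (c (φ n)) - g) := by
      intro n
      set k := φ n
      have hB2 : Bb (T (σ k) g) := H.hTBb _ (hσ0 k) _ hgB
      have hB3 : Bb (T (σ k) (T 1 (c k))) := H.hTBb _ (hσ0 k) _ (hB1 k)
      have i1 := N_tri μ hTg hB2 hgB
      have i2 := N_tri μ hB2 hB3 hgB
      have i3 := N_tri μ hB3 (hB1 k) hgB
      have j1 : N μ (T s g - T (σ k) g) ≤ N μ (T (s - σ k) g - g) := by
        have : T s g = T (σ k) (T (s - σ k) g) := by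
          rw [← H.hsg _ _ (hσ0 k) (sub_nonneg.2 (hσs k)) _ hgB]; congr 1; ring
        rw [this]
        exact H.N_T_sub (hσ0 k) (H.hTBb _ (sub_nonneg.2 (hσs k)) _ hgB) hgB
      have j2 : N μ (T (σ k) g - T (σ k) (T 1 (c k))) ≤ N μ (T 1 (c k) - g) := by
        rw [N_comm μ (f := T 1 (c k))]
        exact H.N_T_sub (hσ0 k) hgB (hB1 k)
      have j3 : N μ (T (σ k) (T 1 (c k)) - T 1 (c k)) ≤
          2 * s * M * μ.real univ * (1 / ((k : ℝ) + 1)) := by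
        have : T (σ k) (T 1 (c k)) = T 1 (T (σ k) (c k)) := by
          rw [← H.hsg _ _ (hσ0 k) zero_le_one _ (hcB k), add_comm,
            H.hsg _ _ zero_le_one (hσ0 k) _ (hcB k)]
        rw [this]
        refine (H.N_T_sub zero_le_one (H.hTBb _ (hσ0 k) _ (hcB k)) (hcB k)).trans ?_
        have hbd : ∀ x, |(T (σ k) (c k) - c k) x| ≤ 2 * s * M * (1 / ((k : ℝ) + 1)) := by
          intro x
          refine (hcs k (p k) x).trans ?_
          push_cast
          rw [div_le_iff₀ (by positivity)]
          have : 2 * s * M * (1 / ((k : ℝ) + 1)) * ((k : ℝ) + 1) ^ 2 = 2 * (s * (k + 1)) * M := by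
            field_simp
          rw [this]
          have := hpu k
          gcongr
        have := integral_mono (μ := μ)
          (bb_int μ (bb_abs (bb_sub (H.hTBb _ (hσ0 k) _ (hcB k)) (hcB k))))
          (integrable_const _) hbd
        rw [integral_const, smul_eq_mul] at this
        unfold N
        linarith
      linarith
    have hφt := hφ.tendsto_atTop
    have lim : Tendsto (fun n => N μ (T (s - σ (φ n)) g - g) + N μ (T 1 (c (φ n)) - g)
        + 2 * s * M * μ.real univ * (1 / ((φ n : ℝ) + 1)) + N μ (T 1 (c (φ n)) - g))
        atTop (𝓝 (0 + 0 + 2 * s * M * μ.real univ * 0 + 0)) := by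
      refine ((Tendsto.add ?_ hgN).add (Tendsto.const_mul _ ?_)).add hgN
      · exact (H.cont_seq hgB (fun k => sub_nonneg.2 (hσs k)) hσt).comp hφt
      · exact (tendsto_one_div_add_atTop_nhds_zero_nat (𝕜 := ℝ)).comp hφt
    have := ge_of_tendsto' lim key
    simpa using this
  have hu : 0 < μ.real univ := by
    rw [measureReal_def]
    exact ENNReal.toReal_pos (by simpa using hμ) (measure_ne_top _ _)
  have hTg : Bb (T 1 g) := H.hTBb 1 zero_le_one g hgB
  refine ⟨(μ.real univ)⁻¹ • T 1 g, bb_smul _ hTg, fun x => ?_, fun s hs => ?_, ?_⟩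
  · exact mul_nonneg (inv_nonneg.2 hu.le) (H.hpos 1 zero_le_one g hgB hg0 x)
  · rw [H.hsmul s hs _ _ hTg, ← H.hsg _ _ hs zero_le_one _ hgB, add_comm,
      H.hsg _ _ zero_le_one hs _ hgB,
      H.T_congr one_pos (H.hTBb s hs g hgB) hgB (hfix s hs)]
  · simp only [Pi.smul_apply, smul_eq_mul]
    rw [integral_const_mul, H.hinv 1 zero_le_one g hgB, hgi, inv_mul_cancel₀ hu.ne']

/-- The reversible functions along the sequence `r`. -/
def E (μ : Measure Ω) (T : ℝ → (Ω → ℝ) → (Ω → ℝ)) (r : ℕ → ℝ) (h : Ω → ℝ) : Prop :=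
  Bb h ∧ Tendsto (fun n => N μ (T (r n) h - h)) atTop (𝓝 0)

section rev

variable {r : ℕ → ℝ} {h k : Ω → ℝ}

theorem r0 (H : Hyp μ T M) (hr : ∀ n : ℕ, (n : ℝ) ≤ r n) (n : ℕ) : 0 ≤ r n := (Nat.cast_nonneg n).trans (hr n)

theorem E_add (H : Hyp μ T M) (hr : ∀ n : ℕ, (n : ℝ) ≤ r n) (hh : E μ T r h) (hk : E μ T r k) : E μ T r (h + k) := by
  refine ⟨bb_add hh.1 hk.1, ?_⟩
  have h0 := r0 H hr
  have := hh.2.add hk.2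
  rw [add_zero] at this
  refine squeeze_zero (fun _ => N_nonneg μ _) (fun n => ?_) this
  rw [H.hadd _ (h0 n) _ _ hh.1 hk.1, add_sub_add_comm]
  exact N_add μ (bb_sub (H.hTBb _ (h0 n) _ hh.1) hh.1) (bb_sub (H.hTBb _ (h0 n) _ hk.1) hk.1)

theorem E_smul (H : Hyp μ T M) (hr : ∀ n : ℕ, (n : ℝ) ≤ r n) (c : ℝ) (hh : E μ T r h) : E μ T r (c • h) := by
  refine ⟨bb_smul c hh.1, ?_⟩
  have h0 := r0 H hr
  have := hh.2.const_mul |c|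
  rw [mul_zero] at this
  refine this.congr fun n => ?_
  rw [H.hsmul _ (h0 n) _ _ hh.1, ← smul_sub, N_smul]

theorem E_sub (H : Hyp μ T M) (hr : ∀ n : ℕ, (n : ℝ) ≤ r n) (hh : E μ T r h) (hk : E μ T r k) : E μ T r (h - k) := by
  have : h - k = h + (-1 : ℝ) • k := by ext x; simp [sub_eq_add_neg]
  rw [this]
  exact E_add H hr hh (E_smul H hr _ hk)

theorem E_T (H : Hyp μ T M) (hr : ∀ n : ℕ, (n : ℝ) ≤ r n) (ht : 0 ≤ t) (hh : E μ T r h) : E μ T r (T t h) := by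
  refine ⟨H.hTBb t ht _ hh.1, ?_⟩
  have h0 := r0 H hr
  refine squeeze_zero (fun _ => N_nonneg μ _) (fun n => ?_) hh.2
  rw [← H.hsg _ _ (h0 n) ht _ hh.1, add_comm, H.hsg _ _ ht (h0 n) _ hh.1]
  exact H.N_T_sub ht (H.hTBb _ (h0 n) _ hh.1) hh.1

theorem E_isom (H : Hyp μ T M) (hr : ∀ n : ℕ, (n : ℝ) ≤ r n) (ht : 0 ≤ t) (hh : E μ T r h) : N μ (T t h) = N μ h := by
  refine le_antisymm (H.N_T ht hh.1) ?_
  have h0 := r0 H hr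
  have hlim : Tendsto (fun n => N μ (T t h) + N μ (T (r n) h - h)) atTop (𝓝 (N μ (T t h) + 0)) :=
    hh.2.const_add _
  rw [add_zero] at hlim
  refine ge_of_tendsto hlim ?_
  obtain ⟨m, hm⟩ := exists_nat_ge t
  filter_upwards [eventually_ge_atTop m] with n hn
  have h1 : t ≤ r n := hm.trans ((Nat.cast_le.2 hn).trans (hr n))
  have hB := H.hTBb _ (h0 n) _ hh.1
  have h2 : N μ (T (r n) h) ≤ N μ (T t h) := by
    have : T (r n) h = T (r n - t) (T t h) := by
      rw [← H.hsg _ _ (sub_nonneg.2 h1) ht _ hh.1]; congr 1; ring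
    rw [this]
    exact H.N_T (sub_nonneg.2 h1) (H.hTBb t ht _ hh.1)
  have h3 := N_add μ hB (bb_sub hh.1 hB)
  rw [add_sub_cancel, N_comm] at h3
  linarith

theorem E_abs_T (H : Hyp μ T M) (hr : ∀ n : ℕ, (n : ℝ) ≤ r n) (ht : 0 ≤ t) (hh : E μ T r h) :
    (fun x => |T t h x|) =ᵐ[μ] T t (fun x => |h x|) := by
  refine ae_eq_of_le μ (bb_abs (H.hTBb t ht _ hh.1)) (H.hTBb t ht _ (bb_abs hh.1))
    (H.T_abs ht hh.1) ?_
  rw [H.hinv t ht _ (bb_abs hh.1)]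
  exact (E_isom H hr ht hh).ge

theorem E_abs (H : Hyp μ T M) (hr : ∀ n : ℕ, (n : ℝ) ≤ r n) (hh : E μ T r h) : E μ T r (fun x => |h x|) := by
  refine ⟨bb_abs hh.1, ?_⟩
  have h0 := r0 H hr
  refine squeeze_zero (fun _ => N_nonneg μ _) (fun n => ?_) hh.2
  have hB := H.hTBb _ (h0 n) _ hh.1
  have h1 : T (r n) (fun x => |h x|) - (fun x => |h x|) =ᵐ[μ]
      (fun x => |T (r n) h x|) - (fun x => |h x|) :=
    ((E_abs_T H hr (h0 n) hh).symm).sub (ae_eq_refl _)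
  rw [N_congr μ h1]
  exact N_mono μ (bb_sub (bb_abs hB) (bb_abs hh.1)) (bb_sub hB hh.1)
    (fun x => abs_abs_sub_abs_le_abs_sub _ _)

theorem E_min (H : Hyp μ T M) (hr : ∀ n : ℕ, (n : ℝ) ≤ r n) (hh : E μ T r h) (hk : E μ T r k) : E μ T r (fun x => min (h x) (k x)) := by
  have : (fun x => min (h x) (k x)) = (1 / 2 : ℝ) • ((h + k) - fun x => |(h - k) x|) := by
    ext x
    simp only [Pi.smul_apply, Pi.sub_apply, Pi.add_apply, smul_eq_mul]
    rcases le_total (h x) (k x) with hx | hx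
    · rw [min_eq_left hx, abs_of_nonpos (by linarith)]; ring
    · rw [min_eq_right hx, abs_of_nonneg (by linarith)]; ring
  rw [this]
  exact E_smul H hr _ (E_sub H hr (E_add H hr hh hk) (E_abs H hr (E_sub H hr hh hk)))

theorem E_closed (H : Hyp μ T M) (hr : ∀ n : ℕ, (n : ℝ) ≤ r n) {F : ℕ → Ω → ℝ} (hF : ∀ n, E μ T r (F n)) (hh : Bb h)
    (hlim : Tendsto (fun n => N μ (F n - h)) atTop (𝓝 0)) : E μ T r h := by
  refine ⟨hh, ?_⟩
  have h0 := r0 H hr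
  rw [Metric.tendsto_atTop] at hlim ⊢
  intro ε hε
  obtain ⟨m, hm⟩ := hlim (ε / 3) (by positivity)
  have h1 := hm m le_rfl
  obtain ⟨n0, hn0⟩ := (Metric.tendsto_atTop.1 (hF m).2) (ε / 3) (by positivity)
  refine ⟨n0, fun n hn => ?_⟩
  have h2 := hn0 n hn
  rw [Real.dist_eq, sub_zero, abs_of_nonneg (N_nonneg μ _)] at h1 h2 ⊢
  have hB1 := H.hTBb _ (h0 n) _ hh
  have hB2 := H.hTBb _ (h0 n) _ (hF m).1
  have i1 := N_tri μ hB1 hB2 hh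
  have i2 := N_tri μ hB2 (hF m).1 hh
  have i3 := H.N_T_sub (h0 n) hh (hF m).1
  rw [N_comm μ (f := h)] at i3
  linarith

theorem E_congr (H : Hyp μ T M) (hr : ∀ n : ℕ, (n : ℝ) ≤ r n) (hh : E μ T r h) (hk : Bb k) (he : h =ᵐ[μ] k) : E μ T r k := by
  refine E_closed H hr (F := fun _ => h) (fun _ => hh) hk ?_
  have : N μ (h - k) = 0 := by
    rw [N_eq_zero μ (bb_sub hh.1 hk)]
    filter_upwards [he] with x hx
    simp [hx]
  rw [this]
  exact tendsto_const_nhds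

theorem E_rep (H : Hyp μ T M) (hr : ∀ n : ℕ, (n : ℝ) ≤ r n) (hh : E μ T r h) {C : ℝ} (hC : ∀ x, |h x| ≤ C) :
    ∃ w, E μ T r w ∧ (∀ x, |w x| ≤ C * M * M) ∧ h =ᵐ[μ] T 1 w := by
  have hs : ∀ n : ℕ, 0 ≤ r (n + 2) - 2 := fun n => by
    have := hr (n + 2)
    push_cast at this
    have : (0 : ℝ) ≤ n := Nat.cast_nonneg n
    linarith
  have hB : ∀ n, Bb (T (r (n + 2) - 2) h) := fun n => H.hTBb _ (hs n) _ hh.1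
  obtain ⟨φ, w, hφ, hwB, hwb, -, hwN⟩ := H.compact one_pos
    (F := fun n => T (r (n + 2) - 2) h) (C := C * M) hB
    (fun n x => H.T_bound (hs n) hh.1 hC x)
  have hB1 : ∀ n, Bb (T 1 (T (r (n + 2) - 2) h)) := fun n => H.hTBb _ zero_le_one _ (hB n)
  refine ⟨w, ?_, hwb, ?_⟩
  · exact E_closed H hr (fun n => E_T H hr zero_le_one (E_T H hr (hs (φ n)) hh)) hwB hwN
  · have hTw := H.hTBb 1 zero_le_one w hwB
    refine ae_eq_of_N μ hh.1 hTw (le_antisymm ?_ (N_nonneg μ _))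
    have l1 : Tendsto (fun n => N μ (T (r (φ n + 2)) h - h)) atTop (𝓝 0) :=
      hh.2.comp ((tendsto_add_atTop_nat 2).comp hφ.tendsto_atTop)
    have l2 := l1.add hwN
    rw [add_zero] at l2
    refine ge_of_tendsto' l2 fun n => ?_
    have e1 : T (r (φ n + 2)) h = T 1 (T 1 (T (r (φ n + 2) - 2) h)) := by
      rw [← H.hsg _ _ zero_le_one zero_le_one _ (hB _),
        ← H.hsg _ _ (by norm_num) (hs _) _ hh.1]
      congr 1; ring
    have hBr := H.hTBb _ (r0 H hr (φ n + 2)) _ hh.1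
    have i1 := N_tri μ hh.1 hBr hTw
    rw [N_comm μ (f := h) (g := T (r (φ n + 2)) h)] at i1
    have i2 := H.N_T_sub zero_le_one (hB1 (φ n)) hwB
    rw [← e1] at i2
    linarith

/-- bounded sequences of continuous reversible functions have pointwise convergent subsequences -/
theorem E_compact (H : Hyp μ T M) (hr : ∀ n : ℕ, (n : ℝ) ≤ r n) {F : ℕ → Ω → ℝ} {C : ℝ} (hF : ∀ n, E μ T r (F n))
    (hFc : ∀ n, Continuous (F n)) (hC : ∀ n x, |F n x| ≤ C) :
    ∃ (φ : ℕ → ℕ) (h : Ω → ℝ), StrictMono φ ∧ E μ T r h ∧ Continuous h ∧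
      (∀ x, Tendsto (fun n => F (φ n) x) atTop (𝓝 (h x))) ∧
      Tendsto (fun n => N μ (F (φ n) - h)) atTop (𝓝 0) := by
  choose w hwE hwb hwF using fun n => E_rep H hr (hF n) (hC n)
  choose v hvE hvb hvw using fun n => E_rep H hr (hwE n) (hwb n)
  have hTv : ∀ n, Bb (T 1 (v n)) := fun n => H.hTBb 1 zero_le_one _ (hvE n).1
  have hFe : ∀ n, F n = T 1 (T 1 (v n)) := fun n => by
    rw [← H.T_congr one_pos (hwE n).1 (hTv n) (hvw n)]
    exact H.cont_eq (hFc n) (H.hSF 1 one_pos _ (hwE n).1) (hwF n)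
  obtain ⟨φ, z, hφ, hzB, hzb, -, hzN⟩ := H.compact one_pos (fun n => (hvE n).1) hvb
  have hp : ∀ x, Tendsto (fun n => F (φ n) x) atTop (𝓝 (T 1 z x)) := fun x => by
    have := H.pointwise one_pos (fun n => hTv (φ n)) hzB
      (fun n x => H.T_bound zero_le_one (hvE (φ n)).1 (hvb (φ n)) x) hzN x
    simp_rw [hFe]
    exact this
  have hB : Bb (T 1 z) := H.hTBb 1 zero_le_one z hzB
  have hN := N_tendsto_of_pointwise μ (fun n => (hF (φ n)).1) hB (fun n => hC (φ n))
    (Eventually.of_forall hp)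
  exact ⟨φ, T 1 z, hφ, E_closed H hr (fun n => hF (φ n)) hB hN, H.hSF 1 one_pos z hzB, hp, hN⟩

theorem iter_fix (H : Hyp μ T M) (hr : ∀ n : ℕ, (n : ℝ) ≤ r n) (hh : Bb h) (ht : 0 ≤ t) (hfix : T t h = h) (n : ℕ) : T (n * t) h = h := by
  induction n with
  | zero => simpa using H.hT0 h hh
  | succ n ih =>
    push_cast
    rw [add_mul, one_mul, H.hsg _ _ (by positivity) ht _ hh, hfix, ih]

theorem key (H : Hyp μ T M) (hr : ∀ n : ℕ, (n : ℝ) ≤ r n) (hμ : μ ≠ 0) {e : Ω → ℝ} (he : Bb e) (he0 : ∀ x, 0 ≤ e x)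
    (hefix : ∀ t, 0 ≤ t → T t e = e) (heint : ∫ x, e x ∂μ = 1)
    {u : Ω → ℝ} (hu : E μ T r u) (huc : Continuous u) (hu0 : ∀ x, 0 ≤ u x)
    {x0 : Ω} (hx0 : 0 < u x0) (hex0 : 0 < e x0) : ∀ x, 0 < e x → 0 < u x := by
  have hec : Continuous e := by
    have := H.hSF 1 one_pos e he
    rwa [hefix 1 zero_le_one] at this
  have heE : E μ T r e := by
    refine ⟨he, ?_⟩
    have : ∀ n, N μ (T (r n) e - e) = 0 := fun n => by
      rw [hefix _ (r0 H hr n)]; simp [N]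
    simp_rw [this]
    exact tendsto_const_nhds
  let P : (Ω → ℝ) → Prop := fun h => E μ T r h ∧ Continuous h ∧ (∀ x, 0 ≤ h x) ∧
    (∀ x, h x ≤ e x) ∧ h x0 = e x0
  have hPe : P e := ⟨heE, hec, he0, fun _ => le_rfl, rfl⟩
  obtain ⟨D, hD⟩ := he.2
  -- a minimizer
  obtain ⟨h, hP, hmin⟩ : ∃ h, P h ∧ ∀ k, P k → ∫ x, h x ∂μ ≤ ∫ x, k x ∂μ := by
    let S : Set ℝ := (fun h : Ω → ℝ => ∫ x, h x ∂μ) '' {h | P h}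
    have hne : S.Nonempty := ⟨_, e, hPe, rfl⟩
    have hbd : BddBelow S := ⟨0, by
      rintro _ ⟨h, hh, rfl⟩
      exact integral_nonneg hh.2.2.1⟩
    obtain ⟨u, -, hut, huS⟩ := exists_seq_tendsto_sInf hne hbd
    choose F hFP hFu using huS
    obtain ⟨φ, h, hφ, hE, hc, hp, hN⟩ := E_compact H hr (F := F) (C := D)
      (fun n => (hFP n).1) (fun n => (hFP n).2.1) (fun n x => by
        rw [abs_of_nonneg ((hFP n).2.2.1 x)]
        exact ((hFP n).2.2.2.1 x).trans ((le_abs_self _).trans (hD x)))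
    refine ⟨h, ⟨hE, hc, fun x => ge_of_tendsto' (hp x) fun n => (hFP _).2.2.1 x,
      fun x => le_of_tendsto' (hp x) fun n => (hFP _).2.2.2.1 x,
      tendsto_nhds_unique (hp x0) (by
        simp_rw [(hFP _).2.2.2.2]; exact tendsto_const_nhds)⟩, fun k hk => ?_⟩
    have h1 := integral_tendsto_of_N μ (fun n => (hFP (φ n)).1.1) hE.1 hN
    have h2 : Tendsto (fun n => ∫ x, F (φ n) x ∂μ) atTop (𝓝 (sInf S)) := by
      have := hut.comp hφ.tendsto_atTop
      refine this.congr fun n => ?_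
      exact (hFu (φ n)).symm
    rw [tendsto_nhds_unique h1 h2]
    exact csInf_le hbd ⟨k, hk, rfl⟩
  have hmin' : ∀ k, P k → (∀ x, k x ≤ h x) → k = h := by
    intro k hk hkh
    exact H.cont_eq hk.2.1 hP.2.1 (ae_eq_of_le μ hk.1.1 hP.1.1 hkh (hmin k hk))
  obtain ⟨hE, hc, hh0, hhe, hhx⟩ := id hP
  -- dichotomy
  have hk1 : E μ T r ((2 : ℝ) • h - e) := E_sub H hr (E_smul H hr 2 hE) heE
  have hdich : ∀ x, |2 * h x - e x| = e x := by
    have hk2 : E μ T r ((1 / 2 : ℝ) • ((fun x => |((2 : ℝ) • h - e) x|) + ((2 : ℝ) • h - e))) :=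
      E_smul H hr _ (E_add H hr (E_abs H hr hk1) hk1)
    have hval : ∀ x, ((1 / 2 : ℝ) • ((fun x => |((2 : ℝ) • h - e) x|) + ((2 : ℝ) • h - e))) x
        = (|2 * h x - e x| + (2 * h x - e x)) / 2 := fun x => by
      simp only [Pi.smul_apply, Pi.add_apply, Pi.sub_apply, smul_eq_mul]; ring
    have := hmin' _ ⟨hk2, ?_, ?_, ?_, ?_⟩ ?_
    · intro x
      have h1 := congrFun this x
      rw [hval] at h1
      have := abs_nonneg (2 * h x - e x)
      linarith
    · have : Continuous fun x => (|2 * h x - e x| + (2 * h x - e x)) / 2 := by fun_prop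
      exact this.congr fun x => (hval x).symm
    · intro x; rw [hval]; linarith [neg_abs_le (2 * h x - e x)]
    · intro x; rw [hval]
      have a1 := hh0 x
      have a2 := hhe x
      rcases abs_cases (2 * h x - e x) with ⟨a, b⟩ | ⟨a, b⟩ <;> rw [a] <;> linarith
    · rw [hval, hhx, abs_of_nonneg (by linarith)]; ring
    · intro x; rw [hval]
      have a1 := hh0 x
      have a2 := hhe x
      rcases abs_cases (2 * h x - e x) with ⟨a, b⟩ | ⟨a, b⟩ <;> rw [a] <;> linarith
  have hTd : ∀ s, 0 < s → ∀ x, |2 * T s h x - e x| = e x := by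
    intro s hs x
    have h1 := E_abs_T H hr hs.le hk1
    have h2 : (fun x => |((2 : ℝ) • h - e) x|) = e := by
      ext x
      simpa using hdich x
    rw [h2, hefix s hs.le] at h1
    have h3 := H.cont_eq (H.hSF s hs _ hk1.1).abs hec h1
    have h4 := congrFun h3 x
    rw [H.T_sub hs.le (bb_smul 2 hE.1) he, H.hsmul s hs.le _ _ hE.1, hefix s hs.le] at h4
    simpa using h4
  -- h is a fixed point
  have hfix : ∀ t, 0 ≤ t → T t h = h := by
    intro t ht
    rcases ht.eq_or_lt with rfl | ht
    · exact H.hT0 h hE.1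
    let s : ℕ → ℝ := fun n => t / ((n : ℝ) + 1)
    have hs : ∀ n, 0 < s n := fun n => by positivity
    have hst : Tendsto s atTop (𝓝 0) := by
      have := (tendsto_one_div_add_atTop_nhds_zero_nat (𝕜 := ℝ)).const_mul t
      simpa [s, div_eq_mul_inv] using this
    have hhD : ∀ x, |h x| ≤ D := fun x => by
      rw [abs_of_nonneg (hh0 x)]
      exact (hhe x).trans ((le_abs_self _).trans (hD x))
    obtain ⟨w, hwE, hwb, hw⟩ := E_rep H hr hE hhD
    have hw' : h = T 1 w := H.cont_eq hc (H.hSF 1 one_pos w hwE.1) hw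
    have hlim : Tendsto (fun n => T (s n) h x0) atTop (𝓝 (h x0)) := by
      have := H.pointwise one_pos (F := fun n => T (s n) w) (fun n => H.hTBb _ (hs n).le _ hwE.1)
        hwE.1 (fun n x => H.T_bound (hs n).le hwE.1 hwb x)
        (H.cont_seq hwE.1 (fun n => (hs n).le) hst) x0
      rw [← hw'] at this
      refine this.congr fun n => ?_
      rw [← H.hsg _ _ zero_le_one (hs n).le _ hwE.1, add_comm,
        H.hsg _ _ (hs n).le zero_le_one _ hwE.1, ← hw']
    rw [hhx] at hlim
    obtain ⟨n, hn⟩ := (hlim.eventually (lt_mem_nhds hex0)).exists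
    have hs0 := (hs n).le
    have hTx0 : T (s n) h x0 = e x0 := by
      have h1 := hTd (s n) (hs n) x0
      rcases abs_cases (2 * T (s n) h x0 - e x0) with ⟨a, b⟩ | ⟨a, b⟩ <;> rw [a] at h1 <;> linarith
    have hTE := E_T H hr hs0 hE
    have hm := hmin' (fun x => min (T (s n) h x) (h x)) ⟨E_min H hr hTE hE,
      (H.hSF _ (hs n) _ hE.1).min hc,
      fun x => le_min (H.hpos _ hs0 _ hE.1 hh0 x) (hh0 x),
      fun x => (min_le_right _ _).trans (hhe x), by simp [hTx0, hhx]⟩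
      (fun x => min_le_right _ _)
    have hle : ∀ x, h x ≤ T (s n) h x := fun x => by
      have := congrFun hm x
      rw [← this]
      exact min_le_left _ _
    have hfx : T (s n) h = h := (H.cont_eq hc (H.hSF _ (hs n) _ hE.1)
      (ae_eq_of_le μ hE.1 hTE.1 hle (H.hinv _ hs0 _ hE.1).le)).symm
    have := iter_fix H hr hE.1 hs0 hfx (n + 1)
    have ht' : ((n + 1 : ℕ) : ℝ) * s n = t := by
      simp only [s]; push_cast; field_simp
    rwa [ht'] at this
  have hspan := H.fix_span hμ he hefix heint hE.1 hfix
  have hone : ∫ x, h x ∂μ = 1 := by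
    have h1 := hspan x0
    rw [hhx] at h1
    have : (∫ x, h x ∂μ - 1) * e x0 = 0 := by linarith
    rcases mul_eq_zero.1 this with h2 | h2
    · linarith
    · exact absurd h2 hex0.ne'
  have hall : ∀ k, P k → k = e := fun k hk =>
    H.cont_eq hk.2.1 hec (ae_eq_of_le μ hk.1.1 he hk.2.2.2.1 (by
      rw [heint, ← hone]; exact hmin k hk))
  obtain ⟨n, hn⟩ := exists_nat_ge (e x0 / u x0)
  rw [div_le_iff₀ hx0] at hn
  have hfin := hall (fun x => min (((n : ℝ) • u) x) (e x)) ⟨E_min H hr (E_smul H hr _ hu) heE,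
    (huc.const_smul _).min hec,
    fun x => le_min (by simpa using mul_nonneg (Nat.cast_nonneg n) (hu0 x)) (he0 x),
    fun x => min_le_right _ _, by simpa using hn⟩
  intro x hx
  by_contra hcon
  have hux : u x = 0 := le_antisymm (not_lt.1 hcon) (hu0 x)
  have := congrFun hfin x
  simp only [Pi.smul_apply, hux, smul_zero] at this
  have := this ▸ min_le_left (0 : ℝ) (e x)
  linarith

end rev

theorem converge (H : Hyp μ T M) (hμ : μ ≠ 0) {e : Ω → ℝ} (he : Bb e) (he0 : ∀ x, 0 ≤ e x)
    (hefix : ∀ t, 0 ≤ t → T t e = e) (heint : ∫ x, e x ∂μ = 1) (hepos : ∀ᵐ x ∂μ, 0 < e x)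
    (hf : Bb f) (hf0 : ∫ x, f x ∂μ = 0) : Tendsto (fun t => N μ (T t f)) atTop (𝓝 0) := by
  obtain ⟨C, hC⟩ := hf.2
  have hn : ∀ n : ℕ, (0 : ℝ) ≤ n := fun n => Nat.cast_nonneg n
  obtain ⟨φ, g, hφ, hgB, hgb, -, hgN⟩ := H.compact one_pos (F := fun n : ℕ => T n f)
    (C := C * M) (fun n => H.hTBb _ (hn n) _ hf) (fun n x => H.T_bound (hn n) hf hC x)
  let τ : ℕ → ℝ := fun n => 1 + (φ n : ℝ)
  have hτ0 : ∀ n, 0 ≤ τ n := fun n => by positivity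
  have hτB : ∀ n, Bb (T (τ n) f) := fun n => H.hTBb _ (hτ0 n) _ hf
  have hgN' : Tendsto (fun n => N μ (T (τ n) f - g)) atTop (𝓝 0) := by
    refine hgN.congr fun n => ?_
    rw [H.hsg _ _ zero_le_one (hn _) _ hf]
  have hgi : ∫ x, g x ∂μ = 0 := by
    refine tendsto_nhds_unique (integral_tendsto_of_N μ hτB hgB hgN') ?_
    simp_rw [H.hinv _ (hτ0 _) _ hf, hf0]
    exact tendsto_const_nhds
  let κ : ℕ → ℕ := fun n => φ n + n
  let r : ℕ → ℝ := fun n => τ (κ n) - τ n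
  have hr : ∀ n : ℕ, (n : ℝ) ≤ r n := by
    intro n
    have : φ n + n ≤ φ (κ n) := hφ.id_le (κ n)
    have : (φ n : ℝ) + n ≤ φ (κ n) := by exact_mod_cast this
    simp only [r, τ]
    linarith
  have hκ : Tendsto κ atTop atTop := tendsto_atTop_mono (fun n => Nat.le_add_left n _) tendsto_id
  have hgE : E μ T r g := by
    refine ⟨hgB, ?_⟩
    have l := hgN'.add (hgN'.comp hκ)
    rw [add_zero] at l
    refine squeeze_zero (fun _ => N_nonneg μ _) (fun n => ?_) l
    have hr0 : 0 ≤ r n := (hn n).trans (hr n)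
    have e1 : T (τ (κ n)) f = T (r n) (T (τ n) f) := by
      rw [← H.hsg _ _ hr0 (hτ0 n) _ hf]; congr 1; simp [r]
    have i1 := N_tri μ (H.hTBb _ hr0 _ hgB) (hτB (κ n)) hgB
    have i2 := H.N_T_sub hr0 hgB (hτB n)
    rw [← e1, N_comm μ (f := g)] at i2
    simp only [Function.comp_apply]
    linarith
  obtain ⟨w, hwE, -, hgw⟩ := E_rep H hr hgE hgb
  have hq := H.hTBb 1 zero_le_one w hwE.1
  have hqc := H.hSF 1 one_pos w hwE.1
  have hqE : E μ T r (T 1 w) := E_T H hr zero_le_one hwE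
  have hqi : ∫ x, T 1 w x ∂μ = 0 := by rw [← hgi]; exact (integral_congr_ae hgw).symm
  generalize T 1 w = q at hgw hq hqc hqE hqi
  have hopen : μ.IsOpenPosMeasure := ⟨fun U hU hne => (H.hμpos U hU hne).ne'⟩
  -- q ≤ 0
  have hqneg : ∀ x, q x ≤ 0 := by
    by_contra hcon
    push Not at hcon
    obtain ⟨y, hy⟩ := hcon
    have hU : IsOpen {x | 0 < q x} := isOpen_lt continuous_const hqc
    have hUpos := H.hμpos _ hU ⟨y, hy⟩
    obtain ⟨x0, hx0, hex0⟩ : ∃ x0, 0 < q x0 ∧ 0 < e x0 := by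
      by_contra hno
      push Not at hno
      have : μ {x | 0 < q x} = 0 := by
        rw [measure_eq_zero_iff_ae_notMem]
        filter_upwards [hepos] with x hx hx2
        exact absurd (hno x hx2) (not_le.2 hx)
      exact hUpos.ne' this
    have hval : ∀ x, ((fun x => |q x|) + q) x = |q x| + q x := fun x => rfl
    have hk := key H hr hμ he he0 hefix heint (u := (fun x => |q x|) + q)
      (E_add H hr (E_abs H hr hqE) hqE) (hqc.abs.add hqc)
      (fun x => by rw [hval]; linarith [neg_abs_le (q x)])
      (x0 := x0) (by rw [hval]; linarith [abs_nonneg (q x0)]) hex0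
    have h1 : ∀ᵐ x ∂μ, 0 < q x := by
      filter_upwards [hepos] with x hx
      have h2 := hk x hx
      rw [hval] at h2
      by_contra hc
      rw [abs_of_nonpos (not_lt.1 hc)] at h2
      linarith
    have h3 := (integral_eq_zero_iff_of_nonneg_ae (h1.mono fun x hx => hx.le) (bb_int μ hq)).1 hqi
    have : ∀ᵐ x ∂μ, False := by
      filter_upwards [h1, h3] with x a b
      simp only [Pi.zero_apply] at b
      linarith
    simp only [eventually_false_iff_eq_bot, ae_eq_bot] at this
    exact hμ this
  have hg0 : N μ g = 0 := by
    rw [N_congr μ hgw, N]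
    have : ∀ x, |q x| = - q x := fun x => abs_of_nonpos (hqneg x)
    simp_rw [this]
    rw [integral_neg, hqi, neg_zero]
  rw [Metric.tendsto_atTop]
  intro ε hε
  obtain ⟨n, hn'⟩ := (Metric.tendsto_atTop.1 hgN') ε hε
  have h1 := hn' n le_rfl
  rw [Real.dist_eq, sub_zero, abs_of_nonneg (N_nonneg μ _)] at h1
  refine ⟨τ n, fun t ht => ?_⟩
  rw [Real.dist_eq, sub_zero, abs_of_nonneg (N_nonneg μ _)]
  have e1 : T t f = T (t - τ n) (T (τ n) f) := by
    rw [← H.hsg _ _ (sub_nonneg.2 ht) (hτ0 n) _ hf]; congr 1; ring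
  rw [e1]
  have i1 := H.N_T (sub_nonneg.2 ht) (hτB n)
  have i2 := N_add μ (bb_sub (hτB n) hgB) hgB
  rw [sub_add_cancel] at i2
  linarith

theorem main (H : Hyp μ T M) : ∃ e : Ω → ℝ, Bb e ∧ (∀ t, 0 ≤ t → T t e = e) ∧ (∀ᵐ x ∂μ, 0 < e x) ∧
      (∀ f, Bb f → (∀ t, 0 ≤ t → T t f = f) → ∃ c : ℝ, f = fun x => c * e x) ∧
      ∀ f, Bb f → ∀ K : Set Ω, IsCompact K →
        TendstoUniformlyOn (fun t x => T t f x)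
          (fun x => (∫ y, f y ∂μ) * e x) atTop K := by
  by_cases hμ : μ = 0
  · have hemp : IsEmpty Ω := by
      by_contra h
      rw [not_isEmpty_iff] at h
      have := H.hμpos univ isOpen_univ univ_nonempty
      simp [hμ] at this
    refine ⟨fun _ => 0, bb_const 0, fun t _ => Subsingleton.elim _ _, ?_,
      fun f _ _ => ⟨0, Subsingleton.elim _ _⟩, fun f _ K _ => ?_⟩
    · simp [hμ]
    · intro u hu
      exact Eventually.of_forall fun t x => isEmptyElim x
  obtain ⟨e, he, he0, hefix, heint⟩ := H.exists_fix hμ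
  have hepos : ∀ᵐ x ∂μ, 0 < e x := by
    rcases H.invariant he he0 hefix with h | h
    · rw [integral_congr_ae h] at heint
      simp at heint
    · exact h
  refine ⟨e, he, hefix, hepos, fun f hf hfix => ⟨_, funext
    (H.fix_span hμ he hefix heint hf hfix)⟩, fun f hf K hK => ?_⟩
  let c := ∫ y, f y ∂μ
  have hpB : Bb (f - c • e) := bb_sub hf (bb_smul _ he)
  have hpi : ∫ x, (f - c • e) x ∂μ = 0 := by
    simp only [Pi.sub_apply, Pi.smul_apply, smul_eq_mul]
    rw [integral_sub (bb_int μ hf) ((bb_int μ he).const_mul _), integral_const_mul, heint]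
    simp [c]
  have hconv := H.converge hμ he he0 hefix heint hepos hpB hpi
  obtain ⟨C, hC⟩ := hpB.2
  refine tendstoUniformlyOn_of_seq_tendstoUniformlyOn fun s hs => ?_
  have hs' : Tendsto (fun n => max (s n - 1) 0) atTop atTop :=
    tendsto_atTop_mono (fun n => le_max_left _ _) (tendsto_atTop_add_const_right _ (-1) hs)
  have hU := H.unif0 one_pos (F := fun n => T (max (s n - 1) 0) (f - c • e)) (C := C * M)
    (fun n => H.hTBb _ (le_max_right _ _) _ hpB)
    (fun n x => H.T_bound (le_max_right _ _) hpB hC x) (hconv.comp hs') hK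
  rw [Metric.tendstoUniformlyOn_iff] at hU ⊢
  intro ε hε
  filter_upwards [hU ε hε, hs.eventually_ge_atTop 1] with n hn hn1 x hx
  have h1 := hn x hx
  rw [max_eq_left (by linarith), ← H.hsg _ _ zero_le_one (by linarith) _ hpB,
    add_sub_cancel, H.T_sub (by linarith) hf (bb_smul _ he), H.hsmul _ (by linarith) _ _ he,
    hefix _ (by linarith)] at h1
  rw [Real.dist_eq] at h1 ⊢
  simp only [Pi.sub_apply, Pi.smul_apply, smul_eq_mul, c] at h1
  rw [zero_sub, neg_sub] at h1
  exact h1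

end Hyp

end semigroup

end DoobAux

theorem stmt_17 {Ω : Type*} [TopologicalSpace Ω] [T2Space Ω] [SecondCountableTopology Ω]
    [MeasurableSpace Ω] [BorelSpace Ω]
    (μ : Measure Ω) [IsFiniteMeasure μ]
    (hμpos : ∀ U : Set Ω, IsOpen U → U.Nonempty → 0 < μ U)
    (T : ℝ → (Ω → ℝ) → (Ω → ℝ))
    (hTBb : ∀ t, 0 ≤ t → ∀ f, Bb f → Bb (T t f))
    (hadd : ∀ t, 0 ≤ t → ∀ f g, Bb f → Bb g → T t (f + g) = T t f + T t g)
    (hsmul : ∀ t, 0 ≤ t → ∀ (c : ℝ) (f), Bb f → T t (c • f) = c • T t f)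
    (hpos : ∀ t, 0 ≤ t → ∀ f, Bb f → (∀ x, 0 ≤ f x) → ∀ x, 0 ≤ T t f x)
    (hT0 : ∀ f, Bb f → T 0 f = f)
    (hsg : ∀ s t : ℝ, 0 ≤ s → 0 ≤ t → ∀ f, Bb f → T (s + t) f = T s (T t f))
    (hSF : ∀ t, 0 < t → ∀ f, Bb f → Continuous (T t f))
    (hbdd : ∃ M : ℝ, ∀ t, 0 ≤ t → ∀ f, Bb f → (∀ x, |f x| ≤ 1) → ∀ x, |T t f x| ≤ M)
    (hdelta : ∀ t, 0 < t → ∀ x : Ω, ∃ ν : Measure Ω, IsFiniteMeasure ν ∧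
      ∀ f, Bb f → T t f x = ∫ y, f y ∂ν)
    (hinv : ∀ t, 0 ≤ t → ∀ f, Bb f → ∫ x, T t f x ∂μ = ∫ x, f x ∂μ)
    (hirr : ∀ B : Set Ω, MeasurableSet B →
      (∀ t, 0 ≤ t → ∀ f, Bb f → (∀ᵐ x ∂μ, x ∉ B → f x = 0) →
        ∀ᵐ x ∂μ, x ∉ B → T t f x = 0) → μ B = 0 ∨ μ Bᶜ = 0)
    (hcont : ∀ f, Bb f →
      Tendsto (fun t => ∫ x, |T t f x - f x| ∂μ) (nhdsWithin 0 (Ioi 0)) (nhds 0)) :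
    ∃ e : Ω → ℝ, Bb e ∧ (∀ t, 0 ≤ t → T t e = e) ∧ (∀ᵐ x ∂μ, 0 < e x) ∧
      (∀ f, Bb f → (∀ t, 0 ≤ t → T t f = f) → ∃ c : ℝ, f = fun x => c * e x) ∧
      ∀ f, Bb f → ∀ K : Set Ω, IsCompact K →
        TendstoUniformlyOn (fun t x => T t f x)
          (fun x => (∫ y, f y ∂μ) * e x) atTop K := by
  obtain ⟨M, hM⟩ := hbdd
  exact DoobAux.Hyp.main (M := M) ⟨hμpos, hTBb, hadd, hsmul, hpos, hT0, hsg, hSF, hM, hdelta, hinv,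
    hirr, hcont⟩
end
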